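/- Let ν : [0,∞) → [1,∞) be continuous, strictly increasing and surjective onto [1,∞) with ν(0) = 1, and assume the associated function φ is a norm on ℝ². Let f : ℝ² → ℝ be three times continuously differentiable and x₀ a point with ∇f(x₀) ≠ 0. For each ρ > 0 let m(ρ) be any median of f on the amoeba A_ρ(f; x₀) built from f itself with the amoeba metric induced by ν and contrast scale β > 0. Then, as ρ → 0⁺, m(ρ) = f(x₀) + (ρ²/6)·[|∇f| div(g(|∇f|) ∇f/|∇f|)](x₀) + o(ρ²), where for z > 0 the edge-stopping function is g(z) = (3/(β² z² ν(1/(βz))³)) · ∫₀¹ ξ² √( (ν⁻¹(ν(1/(βz))/ξ))² − 1/(β² z²) ) dξ, with ν⁻¹ : [1,∞) → [0,∞) the inverse of ν. (Amoeba median filtering approximates a time step of size ρ²/6 of the self-snakes PDE.) -/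

import Mathlib

open MeasureTheory Asymptotics Filter Topology

noncomputable section

abbrev Plane := EuclideanSpace ℝ (Fin 2)

/-- `m` is a median of `u` on the set `A`. -/
def IsMedian (u : Plane → ℝ) (A : Set Plane) (m : ℝ) : Prop :=
  volume {x ∈ A | u x < m} ≤ volume A / 2 ∧ volume {x ∈ A | m < u x} ≤ volume A / 2

/-- a piecewise C¹ curve on [0,1] -/
def PiecewiseC1 (c : ℝ → Plane) : Prop :=
  ContinuousOn c (Set.Icc 0 1) ∧
  ∃ (n : ℕ) (t : ℕ → ℝ), t 0 = 0 ∧ t n = 1 ∧ (∀ i < n, t i < t (i + 1)) ∧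
    ∀ i < n, ContDiffOn ℝ 1 c (Set.Icc (t i) (t (i + 1)))

/-- the amoeba distance on the image `f`, w.r.t. the norm `φ` on ℝ²
(applied to the pair (spatial speed, β · tonal speed)) and contrast scale `β` -/
def amoebaDist (φ : ℝ × ℝ → ℝ) (β : ℝ) (f : Plane → ℝ) (p q : Plane) : ℝ :=
  sInf {L | ∃ c : ℝ → Plane, PiecewiseC1 c ∧ c 0 = p ∧ c 1 = q ∧
    L = ∫ t in (0:ℝ)..1, φ (‖deriv c t‖, β * |deriv (f ∘ c) t|)}

/-- the amoeba of radius ρ around x₀ -/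
def amoeba (φ : ℝ × ℝ → ℝ) (β : ℝ) (f : Plane → ℝ) (x₀ : Plane) (ρ : ℝ) : Set Plane :=
  {y | amoebaDist φ β f x₀ y ≤ ρ}

/-- `φ` is a norm on ℝ × ℝ -/
def IsNorm2 (φ : ℝ × ℝ → ℝ) : Prop :=
  (∀ x, 0 ≤ φ x) ∧ (∀ x, φ x = 0 ↔ x = 0) ∧
  (∀ (a : ℝ) (x), φ (a • x) = |a| * φ x) ∧ (∀ x y, φ (x + y) ≤ φ x + φ y)

/-- the norm φ associated to ν:  φ(s,t) = |t| ν(|s/t|) for t ≠ 0, φ(s,0) = |s| -/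
def phiOf (ν : ℝ → ℝ) : ℝ × ℝ → ℝ :=
  fun st => if st.2 = 0 then |st.1| else |st.2| * ν |st.1 / st.2|

/-- divergence of a planar vector field -/
def div2 (V : Plane → Plane) (x : Plane) : ℝ :=
  ∑ i : Fin 2, fderiv ℝ (fun y => V y i) x (EuclideanSpace.single i 1)

/-- A norm on `ℝ × ℝ` that is invariant under sign changes and restricts to the absolute value on
both coordinate axes. -/
structure IsAbsoluteNorm (φ : ℝ × ℝ → ℝ) : Prop where
  isNorm : IsNorm2 φ
  neg_fst : ∀ s t, φ (-s, t) = φ (s, t)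
  fst_axis : ∀ s, φ (s, 0) = |s|
  snd_axis : ∀ t, φ (0, t) = |t|

lemma isAbsoluteNorm_phiOf {ν : ℝ → ℝ} (hν0 : ν 0 = 1) (hφ : IsNorm2 (phiOf ν)) :
    IsAbsoluteNorm (phiOf ν) where
  isNorm := hφ
  neg_fst s t := by simp [phiOf, neg_div]
  fst_axis s := by simp [phiOf]
  snd_axis t := by
    by_cases ht : t = 0
    · simp [phiOf, ht]
    · simp [phiOf, ht, hν0]

namespace IsAbsoluteNorm

variable {φ : ℝ × ℝ → ℝ}

lemma nonneg (h : IsAbsoluteNorm φ) (x : ℝ × ℝ) : 0 ≤ φ x := h.isNorm.1 x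

lemma smul_eq (h : IsAbsoluteNorm φ) {r : ℝ} (hr : 0 ≤ r) (s t : ℝ) : φ (r * s, r * t) = r * φ (s, t) := by
  simpa [abs_of_nonneg hr] using h.isNorm.2.2.1 r (s, t)

lemma map_neg (h : IsAbsoluteNorm φ) (x : ℝ × ℝ) : φ (-x) = φ x := by
  simpa using h.isNorm.2.2.1 (-1) x

lemma neg_snd (h : IsAbsoluteNorm φ) (s t : ℝ) : φ (s, -t) = φ (s, t) := by
  rw [← h.neg_fst s t, ← h.map_neg (-s, t)]; simp

lemma le_add (h : IsAbsoluteNorm φ) (x y : ℝ × ℝ) : φ (x + y) ≤ φ x + φ y := h.isNorm.2.2.2 x y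

lemma le_abs_add_abs (h : IsAbsoluteNorm φ) (s t : ℝ) : φ (s, t) ≤ |s| + |t| := by
  have := h.le_add (s, 0) (0, t)
  simpa [h.fst_axis, h.snd_axis] using this

lemma abs_fst_le (h : IsAbsoluteNorm φ) (s t : ℝ) : |s| ≤ φ (s, t) := by
  have h1 := h.le_add (s, t) (s, -t)
  rw [h.neg_snd] at h1
  simp only [Prod.mk_add_mk, add_neg_cancel, h.fst_axis] at h1
  rw [show s + s = 2 * s by ring, abs_mul, abs_two] at h1
  linarith

lemma abs_sub_le (h : IsAbsoluteNorm φ) (s t s' t' : ℝ) : |φ (s, t) - φ (s', t')| ≤ |s - s'| + |t - t'| := by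
  have h1 := h.le_add (s', t') (s - s', t - t')
  have h2 := h.le_add (s, t) (s' - s, t' - t)
  simp only [Prod.mk_add_mk, add_sub_cancel] at h1 h2
  have h3 := h.le_abs_add_abs (s - s') (t - t')
  have h4 := h.le_abs_add_abs (s' - s) (t' - t)
  rw [abs_sub_comm s' s, abs_sub_comm t' t] at h4
  rw [abs_le]; constructor <;> linarith

lemma continuous (h : IsAbsoluteNorm φ) : Continuous φ := by
  have : LipschitzWith 2 φ := by
    refine LipschitzWith.of_dist_le_mul fun x y => ?_
    have h1 := h.abs_sub_le x.1 x.2 y.1 y.2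
    have h2 : |x.1 - y.1| ≤ dist x y := by
      rw [Prod.dist_eq, Real.dist_eq]; exact le_max_left _ _
    have h3 : |x.2 - y.2| ≤ dist x y := by
      rw [Prod.dist_eq, Real.dist_eq, Real.dist_eq]; exact le_max_right _ _
    rw [Real.dist_eq]
    push_cast
    linarith
  exact this.continuous

lemma convexOn (h : IsAbsoluteNorm φ) : ConvexOn ℝ Set.univ φ := by
  refine ⟨convex_univ, fun x _ y _ a b ha hb _ => ?_⟩
  have h1 := h.le_add (a • x) (b • y)
  rw [h.isNorm.2.2.1 a x, h.isNorm.2.2.1 b y, abs_of_nonneg ha, abs_of_nonneg hb] at h1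
  simpa using h1

lemma mono_fst (h : IsAbsoluteNorm φ) {s s' : ℝ} (hs : |s| ≤ |s'|) (t : ℝ) : φ (s, t) ≤ φ (s', t) := by
  rcases eq_or_ne s' 0 with h0 | h0
  · have : s = 0 := by simpa [h0] using hs
    rw [this, h0]
  have hle : |s / s'| ≤ 1 := by rw [abs_div]; exact div_le_one_of_le₀ hs (abs_nonneg _)
  obtain ⟨h1, h2⟩ := abs_le.1 hle
  have h3 : 0 ≤ (1 + s / s') / 2 := by linarith
  have h4 : 0 ≤ (1 - s / s') / 2 := by linarith
  have := h.convexOn.2 (Set.mem_univ (s', t)) (Set.mem_univ (-s', t)) h3 h4 (by ring)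
  rw [h.neg_fst] at this
  have e : ((1 + s / s') / 2) • ((s', t) : ℝ × ℝ) + ((1 - s / s') / 2) • (-s', t) = (s, t) := by
    ext
    · simp; field_simp; ring
    · simp; ring
  rw [e] at this
  simp only [smul_eq_mul] at this
  linarith

lemma swap (h : IsAbsoluteNorm φ) : IsAbsoluteNorm (fun x : ℝ × ℝ => φ (x.2, x.1)) where
  isNorm := by
    refine ⟨fun x => h.nonneg _, fun x => ?_, fun a x => ?_, fun x y => ?_⟩
    · rw [h.isNorm.2.1, Prod.ext_iff, Prod.ext_iff, and_comm]; rfl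
    · exact h.isNorm.2.2.1 a (x.2, x.1)
    · exact h.le_add (x.2, x.1) (y.2, y.1)
  neg_fst s t := h.neg_snd t s
  fst_axis s := h.snd_axis s
  snd_axis t := h.fst_axis t

lemma mono (h : IsAbsoluteNorm φ) {s s' t t' : ℝ} (hs : |s| ≤ |s'|) (ht : |t| ≤ |t'|) : φ (s, t) ≤ φ (s', t') :=
  (h.mono_fst hs t).trans (h.swap.mono_fst ht s')

end IsAbsoluteNorm

lemma exists_mem_Ico_partition {t : ℕ → ℝ} {x : ℝ} (n : ℕ) (h0 : t 0 ≤ x) (hn : x < t n) :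
    ∃ i < n, t i ≤ x ∧ x < t (i + 1) := by
  induction n with
  | zero => exact absurd hn (not_lt.2 h0)
  | succ k ih =>
    by_cases hk : x < t k
    · obtain ⟨i, hi, h⟩ := ih hk
      exact ⟨i, by omega, h⟩
    · exact ⟨k, by omega, not_lt.1 hk, hn⟩

lemma exists_deriv_bound_of_piecewise {E : Type*} [NormedAddCommGroup E] [NormedSpace ℝ E]
    {c : ℝ → E} {n : ℕ} {t : ℕ → ℝ} (h0 : t 0 = 0) (hn : t n = 1)
    (hlt : ∀ i < n, t i < t (i + 1))
    (hc : ∀ i < n, ContDiffOn ℝ 1 c (Set.Icc (t i) (t (i + 1)))) :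
    ∃ M : ℝ, ∀ x ∈ Set.Ioo (0 : ℝ) 1 \ Set.range t, DifferentiableAt ℝ c x ∧ ‖deriv c x‖ ≤ M := by
  have hb : ∀ i, ∃ M, i < n → ∀ x ∈ Set.Icc (t i) (t (i + 1)),
      ‖derivWithin c (Set.Icc (t i) (t (i + 1))) x‖ ≤ M := fun i => by
    by_cases hi : i < n
    · obtain ⟨M, hM⟩ := isCompact_Icc.exists_bound_of_continuousOn
        ((hc i hi).continuousOn_derivWithin (uniqueDiffOn_Icc (hlt i hi)) le_rfl)
      exact ⟨M, fun _ => hM⟩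
    · exact ⟨0, fun h => absurd h hi⟩
  choose M hM using hb
  refine ⟨∑ i ∈ Finset.range n, |M i|, fun x hx => ?_⟩
  obtain ⟨i, hi, hi1, hi2⟩ := exists_mem_Ico_partition n (h0.le.trans hx.1.1.le)
    (hx.1.2.trans_eq hn.symm)
  have hne : t i ≠ x := fun h => hx.2 ⟨i, h⟩
  have hnhds : Set.Icc (t i) (t (i + 1)) ∈ 𝓝 x := Icc_mem_nhds (lt_of_le_of_ne hi1 hne) hi2
  refine ⟨((hc i hi).differentiableOn one_ne_zero x ⟨hi1, hi2.le⟩).differentiableAt hnhds, ?_⟩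
  rw [← derivWithin_of_mem_nhds hnhds]
  refine ((hM i hi x ⟨hi1, hi2.le⟩).trans (le_abs_self _)).trans ?_
  exact Finset.single_le_sum (f := fun i => |M i|) (fun _ _ => abs_nonneg _)
    (Finset.mem_range.2 hi)

lemma ae_Ioc_of_forall_Ioo_diff {P : ℝ → Prop} {t : ℕ → ℝ}
    (h : ∀ x ∈ Set.Ioo (0 : ℝ) 1 \ Set.range t, P x) :
    ∀ᵐ x ∂(volume.restrict (Set.Ioc (0 : ℝ) 1)), P x := by
  rw [← restrict_Ioo_eq_restrict_Ioc, ae_restrict_iff' measurableSet_Ioo]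
  filter_upwards [(Set.countable_range t).ae_notMem volume] with x hx hx'
  exact h x ⟨hx', hx⟩

lemma integral_deriv_of_piecewise {E : Type*} [NormedAddCommGroup E] [NormedSpace ℝ E]
    [CompleteSpace E] [SecondCountableTopology E]
    {c : ℝ → E} (hcont : ContinuousOn c (Set.Icc 0 1)) {t : ℕ → ℝ} {M : ℝ}
    (hM : ∀ x ∈ Set.Ioo (0 : ℝ) 1 \ Set.range t, DifferentiableAt ℝ c x ∧ ‖deriv c x‖ ≤ M) :
    IntegrableOn (deriv c) (Set.Ioc 0 1) ∧ ∫ x in Set.Ioc (0 : ℝ) 1, deriv c x = c 1 - c 0 := by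
  have hint : IntegrableOn (deriv c) (Set.Ioc 0 1) := by
    refine Integrable.of_bound (aestronglyMeasurable_deriv c _) M ?_
    exact ae_Ioc_of_forall_Ioo_diff fun x hx => (hM x hx).2
  refine ⟨hint, ?_⟩
  rw [← intervalIntegral.integral_of_le zero_le_one]
  refine integral_eq_of_hasDerivAt_off_countable_of_le c (deriv c) zero_le_one
    (Set.countable_range t) hcont (fun x hx => (hM x hx).1.hasDerivAt) ?_
  exact (intervalIntegrable_iff_integrableOn_Ioc_of_le zero_le_one).2 hint

instance : IsProbabilityMeasure (volume.restrict (Set.Ioc (0 : ℝ) 1)) :=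
  ⟨by simp⟩

section AmoebaDist

variable {φ : ℝ × ℝ → ℝ}

lemma IsAbsoluteNorm.jensen (h : IsAbsoluteNorm φ) {X Y : ℝ → ℝ}
    (hX : IntegrableOn X (Set.Ioc 0 1)) (hY : IntegrableOn Y (Set.Ioc 0 1)) :
    φ (∫ x in Set.Ioc (0 : ℝ) 1, X x, ∫ x in Set.Ioc (0 : ℝ) 1, Y x) ≤
      ∫ x in Set.Ioc (0 : ℝ) 1, φ (X x, Y x) := by
  have hXY : Integrable (fun x => (X x, Y x)) (volume.restrict (Set.Ioc (0 : ℝ) 1)) :=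
    hX.prodMk hY
  have hφ : Integrable (φ ∘ fun x => (X x, Y x)) (volume.restrict (Set.Ioc (0 : ℝ) 1)) := by
    refine (hX.norm.add hY.norm).mono' (h.continuous.comp_aestronglyMeasurable
      hXY.aestronglyMeasurable) (Eventually.of_forall fun x => ?_)
    simp only [Function.comp, Pi.add_apply, Real.norm_eq_abs]
    rw [abs_of_nonneg (h.nonneg _)]
    exact h.le_abs_add_abs _ _
  have := h.convexOn.map_integral_le h.continuous.continuousOn isClosed_univ
    (Eventually.of_forall fun _ => Set.mem_univ _) hXY hφ
  rwa [integral_pair hX hY] at this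

lemma piecewiseC1_of_contDiff {c : ℝ → Plane} (hc : ContDiff ℝ 1 c) : PiecewiseC1 c :=
  ⟨hc.continuous.continuousOn, 1, fun i => i, by simp, by simp, fun i _ => by simp,
    fun i _ => hc.contDiffOn⟩

lemma contDiff_segment (p v : Plane) : ContDiff ℝ 1 (fun t : ℝ => p + t • v) := by fun_prop

lemma IsAbsoluteNorm.le_amoebaDist (h : IsAbsoluteNorm φ) {β : ℝ} {f : Plane → ℝ}
    (hf : ContDiff ℝ 1 f) (p q : Plane) :
    φ (‖q - p‖, β * (f q - f p)) ≤ amoebaDist φ β f p q := by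
  refine le_csInf ⟨_, fun t : ℝ => p + t • (q - p),
    piecewiseC1_of_contDiff (contDiff_segment p (q - p)), by simp, by simp, rfl⟩ ?_
  rintro L ⟨c, ⟨hcont, n, t, h0, hn, hlt, hc⟩, rfl, rfl, rfl⟩
  obtain ⟨M, hM⟩ := exists_deriv_bound_of_piecewise h0 hn hlt hc
  obtain ⟨M', hM'⟩ := exists_deriv_bound_of_piecewise h0 hn hlt
    (fun i hi => hf.comp_contDiffOn (hc i hi))
  obtain ⟨hi, he⟩ := integral_deriv_of_piecewise hcont hM
  obtain ⟨hi', he'⟩ := integral_deriv_of_piecewise (hf.continuous.comp_continuousOn hcont) hM'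
  rw [intervalIntegral.integral_of_le zero_le_one]
  refine le_trans (h.mono ?_ ?_) (h.jensen hi.norm (hi'.abs.const_mul β))
  · rw [abs_of_nonneg (norm_nonneg _), ← he]
    exact (norm_integral_le_integral_norm _).trans (le_abs_self _)
  · rw [integral_const_mul, abs_mul, abs_mul]
    refine mul_le_mul_of_nonneg_left ?_ (abs_nonneg _)
    have e : f (c 1) - f (c 0) = (f ∘ c) 1 - (f ∘ c) 0 := rfl
    rw [e, ← he']
    exact (abs_integral_le_integral_abs).trans (le_abs_self _)

lemma IsAbsoluteNorm.amoebaDist_le (h : IsAbsoluteNorm φ) {β : ℝ} {f : Plane → ℝ}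
    (p v : Plane) {B : ℝ}
    (hB : ∫ t in (0 : ℝ)..1, φ (‖v‖, β * |deriv (fun t : ℝ => f (p + t • v)) t|) ≤ B) :
    amoebaDist φ β f p (p + v) ≤ B := by
  refine csInf_le_of_le ⟨0, ?_⟩ ⟨fun t : ℝ => p + t • v,
    piecewiseC1_of_contDiff (contDiff_segment p v), by simp, by simp, rfl⟩ ?_
  · rintro L ⟨c, -, -, -, rfl⟩
    exact intervalIntegral.integral_nonneg zero_le_one fun _ _ => h.nonneg _
  · refine le_trans (le_of_eq ?_) hB
    refine intervalIntegral.integral_congr fun t _ => ?_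
    have : deriv (fun t : ℝ => p + t • v) t = v := by
      have : HasDerivAt (fun t : ℝ => p + t • v) ((1 : ℝ) • v) t :=
        ((hasDerivAt_id t).smul_const v).const_add p
      simpa using this.deriv
    simp only [this]
    rfl

end AmoebaDist

lemma ContDiff.exists_norm_sub_le_on_closedBall {E F : Type*} [NormedAddCommGroup E]
    [NormedSpace ℝ E] [FiniteDimensional ℝ E] [NormedAddCommGroup F] [NormedSpace ℝ F]
    {u : E → F} (hu : ContDiff ℝ 1 u) (p : E) :
    ∃ C, 0 ≤ C ∧ ∀ x ∈ Metric.closedBall p 1, ‖u x - u p‖ ≤ C * ‖x - p‖ := by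
  have : ProperSpace E := FiniteDimensional.proper ℝ E
  have hp : p ∈ Metric.closedBall p 1 := Metric.mem_closedBall_self zero_le_one
  obtain ⟨C, hC⟩ := (isCompact_closedBall p 1).exists_bound_of_continuousOn
    (hu.continuous_fderiv one_ne_zero).continuousOn
  exact ⟨C, (norm_nonneg _).trans (hC p hp), fun x hx =>
    (convex_closedBall p 1).norm_image_sub_le_of_norm_fderiv_le
      (fun y _ => hu.differentiable one_ne_zero y) hC hp hx⟩

lemma exists_taylor_bound {E : Type*} [NormedAddCommGroup E] [NormedSpace ℝ E]
    [FiniteDimensional ℝ E] {f : E → ℝ} (hf : ContDiff ℝ 3 f) (p : E) :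
    ∃ C, 0 ≤ C ∧ ∀ v, ‖v‖ ≤ 1 →
      ‖fderiv ℝ f (p + v) - fderiv ℝ f p - fderiv ℝ (fderiv ℝ f) p v‖ ≤ C * ‖v‖ ^ 2 ∧
      |f (p + v) - f p - fderiv ℝ f p v - fderiv ℝ (fderiv ℝ f) p v v / 2| ≤ C * ‖v‖ ^ 3 := by
  have hf1 : ContDiff ℝ 2 (fderiv ℝ f) := hf.fderiv_right (by norm_num)
  have hf2 : ContDiff ℝ 1 (fderiv ℝ (fderiv ℝ f)) := hf1.fderiv_right (by norm_num)
  have hsymm : ∀ v w, fderiv ℝ (fderiv ℝ f) p v w = fderiv ℝ (fderiv ℝ f) p w v :=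
    fun v w => (hf.contDiffAt (x := p)).isSymmSndFDerivAt
      (by rw [minSmoothness_of_isRCLikeNormedField]; norm_num) v w
  obtain ⟨C, hC0, h2⟩ := hf2.exists_norm_sub_le_on_closedBall p
  have h1 : ∀ v, ‖v‖ ≤ 1 →
      ‖fderiv ℝ f (p + v) - fderiv ℝ f p - fderiv ℝ (fderiv ℝ f) p v‖ ≤ C * ‖v‖ ^ 2 := by
    intro v hv
    have hd : ∀ x ∈ Metric.closedBall p ‖v‖, HasFDerivWithinAt
        (fun x => fderiv ℝ f x - fderiv ℝ (fderiv ℝ f) p x)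
        (fderiv ℝ (fderiv ℝ f) x - fderiv ℝ (fderiv ℝ f) p) (Metric.closedBall p ‖v‖) x :=
      fun x _ => (((hf1.differentiable two_ne_zero x).hasFDerivAt).sub
        (fderiv ℝ (fderiv ℝ f) p).hasFDerivAt).hasFDerivWithinAt
    have := (convex_closedBall p ‖v‖).norm_image_sub_le_of_norm_hasFDerivWithin_le hd
      (C := C * ‖v‖) (fun x hx => (h2 x (Metric.closedBall_subset_closedBall hv hx)).trans
        (mul_le_mul_of_nonneg_left (by simpa [dist_eq_norm] using hx) hC0))
      (Metric.mem_closedBall_self (norm_nonneg v)) (y := p + v) (by simp)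
    simp only [add_sub_cancel_left, map_add] at this
    convert! this using 1
    · congr 1; abel
    · ring
  refine ⟨C, hC0, fun v hv => ⟨h1 v hv, ?_⟩⟩
  have hd : ∀ x ∈ Metric.closedBall p ‖v‖, HasFDerivWithinAt
      (fun x => f x - fderiv ℝ f p x - fderiv ℝ (fderiv ℝ f) p (x - p) (x - p) / 2)
      (fderiv ℝ f x - fderiv ℝ f p - fderiv ℝ (fderiv ℝ f) p (x - p))
      (Metric.closedBall p ‖v‖) x := by
    intro x _
    have hq : HasFDerivAt (fun x => fderiv ℝ (fderiv ℝ f) p (x - p) (x - p) / 2)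
        (fderiv ℝ (fderiv ℝ f) p (x - p)) x := by
      have hid : HasFDerivAt (fun x : E => x - p) (ContinuousLinearMap.id ℝ E) x :=
        (hasFDerivAt_id x).sub_const p
      have := (((fderiv ℝ (fderiv ℝ f) p).hasFDerivAt.comp x hid).clm_apply hid).const_mul (1 / 2)
      refine (this.congr_fderiv ?_).congr_of_eventuallyEq (Eventually.of_forall fun y => ?_)
      · ext w
        simp [hsymm w x, hsymm w p]
        ring
      · simp; ring
    exact (((hf.differentiable three_ne_zero x).hasFDerivAt.sub
      (fderiv ℝ f p).hasFDerivAt).sub hq).hasFDerivWithinAt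
  have := (convex_closedBall p ‖v‖).norm_image_sub_le_of_norm_hasFDerivWithin_le hd
    (C := C * ‖v‖ ^ 2) (fun x hx => by
      have hx' : ‖x - p‖ ≤ ‖v‖ := by simpa [dist_eq_norm] using hx
      have := h1 (x - p) (hx'.trans hv)
      rw [add_sub_cancel] at this
      exact this.trans (by gcongr))
    (Metric.mem_closedBall_self (norm_nonneg v)) (y := p + v) (by simp)
  simp only [add_sub_cancel_left, map_add, sub_self, map_zero, zero_div, sub_zero,
    Real.norm_eq_abs] at this
  convert! this using 1
  · congr 1; ring
  · ring

section AmoebaBounds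

variable {φ : ℝ × ℝ → ℝ}

/-- The amoeba distance is enclosed by explicit expressions in the second order jet of `f`. -/
lemma IsAbsoluteNorm.exists_amoebaDist_bounds (h : IsAbsoluteNorm φ) {β : ℝ} (hβ : 0 < β)
    {f : Plane → ℝ} (hf : ContDiff ℝ 3 f) (p : Plane) :
    ∃ C, 0 ≤ C ∧ ∀ v, ‖v‖ ≤ 1 →
      |f (p + v) - f p - fderiv ℝ f p v - fderiv ℝ (fderiv ℝ f) p v v / 2| ≤ C * ‖v‖ ^ 3 ∧
      φ (‖v‖, β * (fderiv ℝ f p v + fderiv ℝ (fderiv ℝ f) p v v / 2)) - C * ‖v‖ ^ 3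
        ≤ amoebaDist φ β f p (p + v) ∧
      amoebaDist φ β f p (p + v) ≤ (φ (‖v‖, β * fderiv ℝ f p v) +
        φ (‖v‖, β * (fderiv ℝ f p v + fderiv ℝ (fderiv ℝ f) p v v))) / 2 + C * ‖v‖ ^ 3 := by
  obtain ⟨C, hC0, hC⟩ := exists_taylor_bound hf p
  refine ⟨(1 + β) * C, by positivity, fun v hv => ⟨?_, ?_, ?_⟩⟩
  · refine (hC v hv).2.trans ?_
    have : 0 ≤ β * C * ‖v‖ ^ 3 := by positivity
    linarith
  · have h1 := h.le_amoebaDist (β := β) (hf.of_le (by norm_num)) p (p + v)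
    have h2 := (abs_le.1 (h.abs_sub_le ‖v‖
      (β * (fderiv ℝ f p v + fderiv ℝ (fderiv ℝ f) p v v / 2)) ‖v‖ (β * (f (p + v) - f p)))).2
    rw [add_sub_cancel_left] at h1
    rw [sub_self, abs_zero, zero_add, ← mul_sub, abs_mul, abs_of_pos hβ, abs_sub_comm,
      ← sub_sub] at h2
    have h3 := mul_le_mul_of_nonneg_left (hC v hv).2 hβ.le
    have : 0 ≤ C * ‖v‖ ^ 3 := by positivity
    linarith
  · set A := fderiv ℝ f p v
    set Q := fderiv ℝ (fderiv ℝ f) p v v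
    have hder : ∀ t : ℝ, deriv (fun t : ℝ => f (p + t • v)) t = fderiv ℝ f (p + t • v) v := by
      intro t
      have h1 : HasDerivAt (fun t : ℝ => p + t • v) ((1 : ℝ) • v) t :=
        ((hasDerivAt_id t).smul_const v).const_add p
      rw [one_smul] at h1
      exact ((hf.differentiable three_ne_zero _).hasFDerivAt.comp_hasDerivAt t h1).deriv
    refine h.amoebaDist_le p v ?_
    simp_rw [hder]
    have hbound : ∀ t ∈ Set.Icc (0 : ℝ) 1, φ (‖v‖, β * |fderiv ℝ f (p + t • v) v|) ≤
        (φ (‖v‖, β * A) + (1 + β) * C * ‖v‖ ^ 3) +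
          t * (φ (‖v‖, β * (A + Q)) - φ (‖v‖, β * A)) := by
      intro t ht
      have htv : ‖t • v‖ ≤ ‖v‖ := by
        rw [norm_smul, Real.norm_eq_abs, abs_of_nonneg ht.1]
        exact mul_le_of_le_one_left (norm_nonneg v) ht.2
      have h1 : |fderiv ℝ f (p + t • v) v - (A + t * Q)| ≤ C * ‖v‖ ^ 3 := by
        have := ContinuousLinearMap.le_of_opNorm_le _ (hC (t • v) (htv.trans hv)).1 v
        simp only [map_smul, _root_.sub_apply, _root_.smul_apply, smul_eq_mul,
          Real.norm_eq_abs] at this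
        rw [← sub_sub]
        refine this.trans ?_
        calc C * ‖t • v‖ ^ 2 * ‖v‖ ≤ C * ‖v‖ ^ 2 * ‖v‖ := by gcongr
          _ = C * ‖v‖ ^ 3 := by ring
      have h2 := (abs_le.1 (h.abs_sub_le ‖v‖ (β * fderiv ℝ f (p + t • v) v)
        ‖v‖ (β * (A + t * Q)))).2
      rw [sub_self, abs_zero, zero_add, ← mul_sub, abs_mul, abs_of_pos hβ] at h2
      have h3 := mul_le_mul_of_nonneg_left h1 hβ.le
      have h4 := h.convexOn.2 (Set.mem_univ (‖v‖, β * A)) (Set.mem_univ (‖v‖, β * (A + Q)))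
        (sub_nonneg.2 ht.2) ht.1 (by ring)
      have e : (1 - t) • ((‖v‖, β * A) : ℝ × ℝ) + t • (‖v‖, β * (A + Q)) =
          (‖v‖, β * (A + t * Q)) := by
        ext <;> simp <;> ring
      rw [e, smul_eq_mul, smul_eq_mul] at h4
      have e2 : φ (‖v‖, β * |fderiv ℝ f (p + t • v) v|) = φ (‖v‖, β * fderiv ℝ f (p + t • v) v) :=
        le_antisymm (h.mono le_rfl (by simp [abs_mul])) (h.mono le_rfl (by simp [abs_mul]))
      have : 0 ≤ C * ‖v‖ ^ 3 := by positivity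
      rw [e2]
      linarith
    have hcont : Continuous fun t : ℝ => φ (‖v‖, β * |fderiv ℝ f (p + t • v) v|) := by
      have := hf.continuous_fderiv three_ne_zero
      exact h.continuous.comp (by fun_prop)
    refine (intervalIntegral.integral_mono_on zero_le_one (hcont.intervalIntegrable _ _)
      ((by fun_prop : Continuous _).intervalIntegrable _ _) hbound).trans (le_of_eq ?_)
    rw [intervalIntegral.integral_add (by simp)
      ((by fun_prop : Continuous _).intervalIntegrable _ _), intervalIntegral.integral_mul_const]
    simp
    ring

end AmoebaBounds

lemma integral_indicator_Iic_sub (a b : ℝ) :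
    ∫ t, ((Set.Iic a).indicator 1 t - (Set.Iic b).indicator 1 t : ℝ) = a - b := by
  have h : ∀ t, ((Set.Iic a).indicator 1 t - (Set.Iic b).indicator 1 t : ℝ) =
      (Set.Ioc b a).indicator 1 t - (Set.Ioc a b).indicator 1 t := by
    intro t
    simp only [Set.indicator_apply, Set.mem_Iic, Set.mem_Ioc, Pi.one_apply]
    split_ifs <;> grind
  simp_rw [h]
  rw [integral_sub, integral_indicator_one measurableSet_Ioc,
    integral_indicator_one measurableSet_Ioc, Real.volume_real_Ioc, Real.volume_real_Ioc]
  · rcases le_total a b with hab | hab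
    · rw [max_eq_right (by linarith), max_eq_left (by linarith)]; ring
    · rw [max_eq_left (by linarith), max_eq_right (by linarith)]; ring
  all_goals exact (integrable_indicator_iff measurableSet_Ioc).2 (integrableOn_const (by simp))

/-- The radial density `r`, cut off to the sublevel set of `E` below `1`. -/
def radialCut (E : ℝ × ℝ → ℝ) (p : ℝ × ℝ) : ℝ :=
  {p : ℝ × ℝ | 0 < p.1 ∧ E p ≤ 1}.indicator Prod.fst p

lemma measurable_radialCut {E : ℝ × ℝ → ℝ} (hE : Measurable E) : Measurable (radialCut E) := by
  refine measurable_fst.indicator ?_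
  exact (measurableSet_lt measurable_const measurable_fst).inter
    (measurableSet_le hE measurable_const)

lemma radialCut_of_le {E : ℝ × ℝ → ℝ} {p : ℝ × ℝ} (h0 : 0 < p.1) (h : E p ≤ 1) :
    radialCut E p = p.1 := Set.indicator_of_mem (by exact ⟨h0, h⟩) _

lemma radialCut_of_lt {E : ℝ × ℝ → ℝ} {p : ℝ × ℝ} (h : 1 < E p) : radialCut E p = 0 :=
  Set.indicator_of_notMem (fun hp => not_le.2 h hp.2) _

lemma radialCut_of_nonpos {E : ℝ × ℝ → ℝ} {p : ℝ × ℝ} (h : p.1 ≤ 0) : radialCut E p = 0 :=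
  Set.indicator_of_notMem (fun hp => not_le.2 hp.1 h) _

section Polar

variable {N e : ℝ → ℝ} {E : ℝ → ℝ × ℝ → ℝ} {C : ℝ}

/-- The region below level `1` of `E` has radial extent at most `R` in the direction `θ`. -/
lemma abs_radialCut_le {F : ℝ × ℝ → ℝ} {R : ℝ} (hF : ∀ r > 0, ∀ θ, F (r, θ) ≤ 1 → r ≤ R)
    (p : ℝ × ℝ) : |radialCut F p| ≤ (Set.Ioc 0 R).indicator (fun _ => R) p.1 := by
  rcases le_or_gt p.1 0 with h0 | h0
  · rw [radialCut_of_nonpos h0, Set.indicator_of_notMem (fun h => not_lt.2 h0 h.1), abs_zero]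
  rcases le_or_gt (F p) 1 with h1 | h1
  · have := hF p.1 h0 p.2 h1
    rw [radialCut_of_le h0 h1, Set.indicator_of_mem (by exact ⟨h0, this⟩), abs_of_pos h0]
    exact this
  · rw [radialCut_of_lt h1, abs_zero]
    refine Set.indicator_nonneg (fun x hx => hx.1.le.trans hx.2) _

lemma integrable_radialCut_section {F : ℝ × ℝ → ℝ} {R : ℝ} (hm : Measurable F)
    (hF : ∀ r > 0, ∀ θ, F (r, θ) ≤ 1 → r ≤ R) (θ : ℝ) :
    Integrable fun r => radialCut F (r, θ) := by
  refine Integrable.mono' (g := (Set.Ioc 0 R).indicator (fun _ => R)) ?_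
    ((measurable_radialCut hm).comp measurable_prodMk_right).aestronglyMeasurable
    (Eventually.of_forall fun r => abs_radialCut_le hF (r, θ))
  exact (integrable_indicator_iff measurableSet_Ioc).2 (by simp)

lemma integrable_radialCut_integral {F : ℝ × ℝ → ℝ} {R : ℝ} (hm : Measurable F)
    (hF : ∀ r > 0, ∀ θ, F (r, θ) ≤ 1 → r ≤ R) (a b : ℝ) :
    IntegrableOn (fun θ => ∫ r, radialCut F (r, θ)) (Set.Ioo a b) := by
  refine Integrable.of_bound (C := ∫ r, (Set.Ioc 0 R).indicator (fun _ => R) r) ?_ ?_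
  · have : StronglyMeasurable (Function.uncurry fun θ r => radialCut F (r, θ)) :=
      ((measurable_radialCut hm).comp measurable_swap).stronglyMeasurable
    exact this.integral_prod_right.aestronglyMeasurable
  · refine Eventually.of_forall fun θ => norm_integral_le_of_norm_le ?_
      (Eventually.of_forall fun r => abs_radialCut_le hF (r, θ))
    exact (integrable_indicator_iff measurableSet_Ioc).2 (by simp)

/-- The level sets of `E` and of `r ↦ r * N θ` differ only near the unperturbed boundary. -/
lemma abs_radialCut_sub_le (hN1 : ∀ θ, 1 ≤ N θ) (hC : 0 ≤ C) {ρ : ℝ} (hρ : 0 < ρ) (hρ1 : ρ ≤ 1)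
    {F : ℝ × ℝ → ℝ}
    (hF : ∀ r > 0, ∀ θ, (F (r, θ) ≤ 1 ∨ r * N θ ≤ 1) → |F (r, θ) - r * N θ| ≤ C * ρ) (θ t : ℝ) :
    |radialCut F ((N θ)⁻¹ + ρ * t, θ) -
        radialCut (fun p => p.1 * N p.2) ((N θ)⁻¹ + ρ * t, θ)| ≤
      (Set.Icc (-C) C).indicator (fun _ => 1 + C) t := by
  have hNpos : 0 < N θ := zero_lt_one.trans_le (hN1 θ)
  set r := (N θ)⁻¹ + ρ * t with hr
  have hrN : r * N θ = 1 + ρ * (t * N θ) := by rw [hr]; field_simp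
  have hnn : 0 ≤ (Set.Icc (-C) C).indicator (fun _ => 1 + C) t :=
    Set.indicator_nonneg (fun _ _ => by linarith) _
  rcases le_or_gt r 0 with h0 | h0
  · rw [radialCut_of_nonpos (p := (r, θ)) h0, radialCut_of_nonpos (p := (r, θ)) h0]
    simpa using hnn
  have key : |r * N θ - 1| ≤ C * ρ → r ≤ (Set.Icc (-C) C).indicator (fun _ => 1 + C) t := by
    intro h
    rw [hrN, add_sub_cancel_left, abs_mul, abs_of_pos hρ, abs_mul, abs_of_pos hNpos] at h
    have h1 : |t| * N θ ≤ C := by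
      by_contra hcon
      push Not at hcon
      nlinarith
    have h2 : |t| ≤ C := by nlinarith [abs_nonneg t, hN1 θ]
    rw [Set.indicator_of_mem (by exact abs_le.1 h2), hr]
    have h3 : (N θ)⁻¹ ≤ 1 := inv_le_one_of_one_le₀ (hN1 θ)
    have h4 : ρ * t ≤ C := by
      have := (abs_le.1 h2).2
      nlinarith
    linarith
  rcases le_or_gt (F (r, θ)) 1 with h1 | h1 <;> rcases le_or_gt (r * N θ) 1 with h2 | h2
  · rw [radialCut_of_le (p := (r, θ)) h0 h1, radialCut_of_le (p := (r, θ)) h0 h2]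
    simpa using hnn
  · rw [radialCut_of_le (p := (r, θ)) h0 h1, radialCut_of_lt (p := (r, θ)) h2, sub_zero,
      abs_of_pos h0]
    have := abs_le.1 (hF r h0 θ (Or.inl h1))
    exact key (abs_le.2 ⟨by nlinarith, by linarith⟩)
  · rw [radialCut_of_lt (p := (r, θ)) h1, radialCut_of_le (p := (r, θ)) h0 h2, zero_sub, abs_neg,
      abs_of_pos h0]
    have := abs_le.1 (hF r h0 θ (Or.inr h2))
    exact key (abs_le.2 ⟨by linarith, by nlinarith⟩)
  · rw [radialCut_of_lt (p := (r, θ)) h1, radialCut_of_lt (p := (r, θ)) h2]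
    simpa using hnn

lemma tendsto_radialCut_sub {θ : ℝ} (hNpos : 0 < N θ) {t : ℝ}
    (hlim : Tendsto (fun ρ => (E ρ ((N θ)⁻¹ + ρ * t, θ) - 1) / ρ) (𝓝[>] 0) (𝓝 (t * N θ + e θ)))
    (ht : t ≠ -e θ / N θ) :
    Tendsto (fun ρ => radialCut (E ρ) ((N θ)⁻¹ + ρ * t, θ) -
        radialCut (fun p => p.1 * N p.2) ((N θ)⁻¹ + ρ * t, θ)) (𝓝[>] 0)
      (𝓝 ((N θ)⁻¹ * ((Set.Iic (-e θ / N θ)).indicator 1 t - (Set.Iic 0).indicator 1 t))) := by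
  have hid : Tendsto (fun ρ : ℝ => (N θ)⁻¹ + ρ * t) (𝓝[>] 0) (𝓝 (N θ)⁻¹) := by
    have : Continuous fun ρ : ℝ => (N θ)⁻¹ + ρ * t := by fun_prop
    simpa using (this.tendsto 0).mono_left nhdsWithin_le_nhds
  have hpos : ∀ᶠ ρ : ℝ in 𝓝[>] 0, 0 < (N θ)⁻¹ + ρ * t :=
    hid.eventually (lt_mem_nhds (inv_pos.2 hNpos))
  rw [mul_sub]
  refine Tendsto.sub ?_ ?_
  · rcases lt_or_gt_of_ne ht with h | h
    · rw [Set.indicator_of_mem (by exact h.le), Pi.one_apply, mul_one]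
      refine hid.congr' ?_
      have h' : t * N θ + e θ < 0 := by rw [lt_div_iff₀ hNpos] at h; linarith
      filter_upwards [hpos, hlim.eventually (gt_mem_nhds h'), self_mem_nhdsWithin] with ρ h1 h2 h3
      have h3' : 0 < ρ := h3
      rw [radialCut_of_le (p := ((N θ)⁻¹ + ρ * t, θ)) h1]
      rw [div_lt_iff₀ h3', zero_mul] at h2
      linarith
    · rw [Set.indicator_of_notMem (by exact not_le.2 h), mul_zero]
      refine tendsto_const_nhds.congr' ?_
      have h' : 0 < t * N θ + e θ := by rw [div_lt_iff₀ hNpos] at h; linarith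
      filter_upwards [hlim.eventually (lt_mem_nhds h'), self_mem_nhdsWithin] with ρ h2 h3
      have h3' : 0 < ρ := h3
      rw [radialCut_of_lt]
      rw [lt_div_iff₀ h3', zero_mul] at h2
      linarith
  · rcases le_or_gt t 0 with h | h
    · rw [Set.indicator_of_mem (by exact h), Pi.one_apply, mul_one]
      refine hid.congr' ?_
      filter_upwards [hpos, self_mem_nhdsWithin] with ρ h1 h3
      have h3' : 0 < ρ := h3
      rw [radialCut_of_le (p := ((N θ)⁻¹ + ρ * t, θ)) h1]
      have : ((N θ)⁻¹ + ρ * t) * N θ = 1 + ρ * (t * N θ) := by field_simp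
      rw [this]
      have : ρ * (t * N θ) ≤ 0 :=
        mul_nonpos_of_nonneg_of_nonpos h3'.le (mul_nonpos_of_nonpos_of_nonneg h hNpos.le)
      linarith
    · rw [Set.indicator_of_notMem (by exact not_le.2 h), mul_zero]
      refine tendsto_const_nhds.congr' ?_
      filter_upwards [self_mem_nhdsWithin] with ρ h3
      have h3' : 0 < ρ := h3
      rw [radialCut_of_lt]
      have : ((N θ)⁻¹ + ρ * t) * N θ = 1 + ρ * (t * N θ) := by field_simp
      rw [this]
      have : 0 < ρ * (t * N θ) := by positivity
      linarith

/-- First order expansion of the area of a perturbed star-shaped region in polar coordinates. -/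
theorem tendsto_integral_radialCut (hNm : Measurable N) (hN1 : ∀ θ, 1 ≤ N θ)
    (hEm : ∀ ρ, Measurable (E ρ)) (hC : 0 ≤ C)
    (hunif : ∀ᶠ ρ in 𝓝[>] 0, ∀ r > 0, ∀ θ, (E ρ (r, θ) ≤ 1 ∨ r * N θ ≤ 1) →
      |E ρ (r, θ) - r * N θ| ≤ C * ρ) {a b : ℝ}
    (hlim : ∀ᵐ θ ∂(volume.restrict (Set.Ioo a b)), ∀ t,
      Tendsto (fun ρ => (E ρ ((N θ)⁻¹ + ρ * t, θ) - 1) / ρ) (𝓝[>] 0) (𝓝 (t * N θ + e θ))) :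
    Tendsto (fun ρ => ((∫ θ in Set.Ioo a b, ∫ r, radialCut (E ρ) (r, θ)) -
        ∫ θ in Set.Ioo a b, ∫ r, radialCut (fun p => p.1 * N p.2) (r, θ)) / ρ) (𝓝[>] 0)
      (𝓝 (∫ θ in Set.Ioo a b, -e θ / N θ ^ 2)) := by
  have hNm' : Measurable fun p : ℝ × ℝ => p.1 * N p.2 := by fun_prop
  have h1 : Tendsto (fun ρ => ∫ θ in Set.Ioo a b, ∫ t,
      (radialCut (E ρ) ((N θ)⁻¹ + ρ * t, θ) -
        radialCut (fun p => p.1 * N p.2) ((N θ)⁻¹ + ρ * t, θ))) (𝓝[>] 0)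
      (𝓝 (∫ θ in Set.Ioo a b, -e θ / N θ ^ 2)) := by
    have hpm : ∀ ρ, Measurable fun p : ℝ × ℝ =>
        radialCut (E ρ) ((N p.1)⁻¹ + ρ * p.2, p.1) -
          radialCut (fun p => p.1 * N p.2) ((N p.1)⁻¹ + ρ * p.2, p.1) := fun ρ => by
      have hm : Measurable fun p : ℝ × ℝ => ((N p.1)⁻¹ + ρ * p.2, p.1) := by fun_prop
      exact ((measurable_radialCut (hEm ρ)).comp hm).sub ((measurable_radialCut hNm').comp hm)
    have hbi : Integrable ((Set.Icc (-C) C).indicator (fun _ => 1 + C)) :=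
      (integrable_indicator_iff measurableSet_Icc).2 (by simp)
    refine tendsto_integral_filter_of_dominated_convergence
      (fun _ => ∫ t, (Set.Icc (-C) C).indicator (fun _ => 1 + C) t) ?_ ?_ (integrable_const _) ?_
    · refine Eventually.of_forall fun ρ => ?_
      have : StronglyMeasurable (Function.uncurry fun θ t =>
          radialCut (E ρ) ((N θ)⁻¹ + ρ * t, θ) -
            radialCut (fun p => p.1 * N p.2) ((N θ)⁻¹ + ρ * t, θ)) := (hpm ρ).stronglyMeasurable
      exact this.integral_prod_right.aestronglyMeasurable
    · filter_upwards [hunif, Ioc_mem_nhdsGT zero_lt_one] with ρ hρ hρ1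
      refine Eventually.of_forall fun θ => norm_integral_le_of_norm_le hbi
        (Eventually.of_forall fun t => abs_radialCut_sub_le hN1 hC hρ1.1 hρ1.2 hρ θ t)
    · filter_upwards [hlim] with θ hθ
      have hNpos : 0 < N θ := zero_lt_one.trans_le (hN1 θ)
      have e1 : -e θ / N θ ^ 2 = ∫ t, (N θ)⁻¹ *
          ((Set.Iic (-e θ / N θ)).indicator 1 t - (Set.Iic 0).indicator 1 t) := by
        rw [integral_const_mul, integral_indicator_Iic_sub]
        field_simp
        ring
      rw [e1]
      refine tendsto_integral_filter_of_dominated_convergence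
        ((Set.Icc (-C) C).indicator (fun _ => 1 + C)) ?_ ?_ hbi ?_
      · exact Eventually.of_forall fun ρ =>
          ((hpm ρ).comp measurable_prodMk_left).aestronglyMeasurable
      · filter_upwards [hunif, Ioc_mem_nhdsGT zero_lt_one] with ρ hρ hρ1
        exact Eventually.of_forall fun t => abs_radialCut_sub_le hN1 hC hρ1.1 hρ1.2 hρ θ t
      · filter_upwards [(Set.countable_singleton (-e θ / N θ)).ae_notMem volume] with t ht
        exact tendsto_radialCut_sub hNpos (hθ t) ht
  refine h1.congr' ?_
  filter_upwards [hunif, Ioc_mem_nhdsGT zero_lt_one] with ρ hρ hρ1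
  have hR : ∀ r > 0, ∀ θ, E ρ (r, θ) ≤ 1 → r ≤ 1 + C := by
    intro r hr θ h
    have h2 := (abs_le.1 (hρ r hr θ (Or.inl h))).1
    have h3 : C * ρ ≤ C := mul_le_of_le_one_right hC hρ1.2
    nlinarith [hN1 θ]
  have hR0 : ∀ r > 0, ∀ θ, (fun p : ℝ × ℝ => p.1 * N p.2) (r, θ) ≤ 1 → r ≤ 1 := by
    intro r hr θ h
    have : r * N θ ≤ 1 := h
    nlinarith [hN1 θ]
  rw [← integral_sub (integrable_radialCut_integral (hEm ρ) hR a b)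
    (integrable_radialCut_integral hNm' hR0 a b), div_eq_inv_mul, ← integral_const_mul]
  refine integral_congr_ae (Eventually.of_forall fun θ => ?_)
  simp only
  rw [← integral_sub (integrable_radialCut_section (hEm ρ) hR θ)
    (integrable_radialCut_section hNm' hR0 θ)]
  have e1 := integral_add_left_eq_self (μ := volume) (fun r => radialCut (E ρ) (r, θ) -
    radialCut (fun p => p.1 * N p.2) (r, θ)) (N θ)⁻¹
  rw [← e1]
  have e2 := Measure.integral_comp_mul_left (fun r => radialCut (E ρ) ((N θ)⁻¹ + r, θ) -
    radialCut (fun p => p.1 * N p.2) ((N θ)⁻¹ + r, θ)) ρ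
  rw [e2, abs_of_pos (inv_pos.2 hρ1.1), smul_eq_mul]

end Polar

lemma integrableOn_radialCut {F : ℝ × ℝ → ℝ} {R : ℝ} (hm : Measurable F)
    (hF : ∀ r > 0, ∀ θ, F (r, θ) ≤ 1 → r ≤ R) (a b : ℝ) :
    IntegrableOn (radialCut F) (Set.univ ×ˢ Set.Ioo a b) := by
  refine Integrable.mono' (g := (Set.Ioc 0 R ×ˢ Set.univ).indicator (fun _ => R)) ?_
    (measurable_radialCut hm).aestronglyMeasurable
    (Eventually.of_forall fun p => (abs_radialCut_le hF p).trans_eq ?_)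
  · rw [integrable_indicator_iff (measurableSet_Ioc.prod MeasurableSet.univ), IntegrableOn,
      Measure.restrict_restrict (measurableSet_Ioc.prod MeasurableSet.univ), Set.prod_inter_prod,
      Set.inter_univ, Set.univ_inter]
    refine integrableOn_const ?_
    rw [Measure.volume_eq_prod, Measure.prod_prod]
    simp [ENNReal.mul_eq_top]
  · simp [Set.indicator_apply]

/-- The area of the part of a sublevel set in the right half-plane, in polar coordinates. -/
lemma measureReal_halfPlane_eq_integral_radialCut {F : ℝ × ℝ → ℝ} (hm : Measurable F) {R : ℝ}
    (hF : ∀ r > 0, ∀ θ, F (r * Real.cos θ, r * Real.sin θ) ≤ 1 → r ≤ R) :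
    volume.real {x : ℝ × ℝ | 0 < x.1 ∧ F x ≤ 1} =
      ∫ θ in Set.Ioo (-(Real.pi / 2)) (Real.pi / 2),
        ∫ r, radialCut (fun p => F (p.1 * Real.cos p.2, p.1 * Real.sin p.2)) (r, θ) := by
  have hm' : Measurable fun p : ℝ × ℝ => F (p.1 * Real.cos p.2, p.1 * Real.sin p.2) := by
    fun_prop
  have hS : MeasurableSet {x : ℝ × ℝ | 0 < x.1 ∧ F x ≤ 1} :=
    (measurableSet_lt measurable_const measurable_fst).inter (measurableSet_le hm measurable_const)
  rw [← integral_indicator_one hS, ← integral_comp_polarCoord_symm,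
    ← integral_indicator polarCoord.open_target.measurableSet]
  have key : ∀ p : ℝ × ℝ, polarCoord.target.indicator (fun p => p.1 •
      {x : ℝ × ℝ | 0 < x.1 ∧ F x ≤ 1}.indicator (1 : ℝ × ℝ → ℝ) (polarCoord.symm p)) p =
      (Set.univ ×ˢ Set.Ioo (-(Real.pi / 2)) (Real.pi / 2)).indicator
        (radialCut (fun p => F (p.1 * Real.cos p.2, p.1 * Real.sin p.2))) p := by
    rintro ⟨r, θ⟩
    simp only [polarCoord, Set.indicator_apply, radialCut, Set.mem_prod, Set.mem_Ioi, Set.mem_Ioo,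
      Set.mem_ofPred_eq, Pi.one_apply, smul_eq_mul, Set.mem_univ, true_and]
    have hpi := Real.pi_pos
    by_cases hr : 0 < r
    · by_cases hθ : -(Real.pi / 2) < θ ∧ θ < Real.pi / 2
      · have h1 := mul_pos hr (Real.cos_pos_of_mem_Ioo hθ)
        have h2 : -Real.pi < θ ∧ θ < Real.pi := ⟨by linarith [hθ.1], by linarith [hθ.2]⟩
        simp [hr, hθ, h1, h2]
      · by_cases h2 : -Real.pi < θ ∧ θ < Real.pi
        · have h3 : Real.cos θ ≤ 0 := by
            rcases le_or_gt θ 0 with h0 | h0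
            · rw [← Real.cos_neg]
              refine Real.cos_nonpos_of_pi_div_two_le_of_le ?_ (by linarith)
              by_contra hcon
              exact hθ ⟨by linarith, by linarith⟩
            · refine Real.cos_nonpos_of_pi_div_two_le_of_le ?_ (by linarith)
              by_contra hcon
              exact hθ ⟨by linarith, by linarith⟩
          have h1 : ¬ 0 < r * Real.cos θ := not_lt.2 (mul_nonpos_of_nonneg_of_nonpos hr.le h3)
          simp [hθ, h1]
        · simp [hθ, h2]
    · simp [hr]
  simp_rw [key]
  rw [integral_indicator (MeasurableSet.univ.prod measurableSet_Ioo), Measure.volume_eq_prod,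
    ← Measure.prod_restrict, integral_prod_symm]
  · simp
  · rw [Measure.prod_restrict]
    exact integrableOn_radialCut hm' hF _ _

section Profile

open Real

variable {ψ : ℝ → ℝ} {K : NNReal}

/-- A function with differentiable pullback along `θ ↦ G * cos θ` is differentiable, away from the
critical points of the cosine. -/
lemma differentiableAt_of_comp_mul_cos {G : ℝ} (hG : G ≠ 0) {θ : ℝ}
    (hθ : θ ∈ Set.Ioo (-(π / 2)) (π / 2)) (h0 : θ ≠ 0)
    (h : DifferentiableAt ℝ (fun t => ψ (G * cos t)) θ) :
    DifferentiableAt ℝ ψ (G * cos θ) := by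
  have hpi := pi_pos
  wlog hpos : 0 < θ generalizing θ
  · have := this (θ := -θ) ⟨by linarith [hθ.2], by linarith [hθ.1]⟩ (neg_ne_zero.2 h0) ?_
      (by rcases lt_or_gt_of_ne h0 with h1 | h1 <;> grind)
    · rwa [cos_neg] at this
    · have h2 : (fun t => ψ (G * cos t)) = (fun t => ψ (G * cos t)) ∘ Neg.neg := by
        ext t; simp
      rw [h2]
      exact DifferentiableAt.comp _ (by rwa [neg_neg]) differentiableAt_id.neg
  have hc0 : 0 < cos θ := cos_pos_of_mem_Ioo hθ
  have hc1 : cos θ < 1 := by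
    rw [← cos_zero]
    exact cos_lt_cos_of_nonneg_of_le_pi_div_two le_rfl hθ.2.le hpos
  have hx : G * cos θ / G = cos θ := by field_simp
  have hac : arccos (G * cos θ / G) = θ := by
    rw [hx, arccos_cos hpos.le (by linarith [hθ.2])]
  have h3 : DifferentiableAt ℝ (fun x => arccos (x / G)) (G * cos θ) := by
    refine DifferentiableAt.comp (f := fun x => x / G) _ (differentiableAt_arccos.2 ?_)
      (differentiableAt_id.div_const G)
    rw [hx]
    exact ⟨by linarith, hc1.ne⟩
  have h4 : DifferentiableAt ℝ ((fun t => ψ (G * cos t)) ∘ fun x => arccos (x / G)) (G * cos θ) :=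
    DifferentiableAt.comp _ (by rwa [hac]) h3
  refine h4.congr_of_eventuallyEq ?_
  have h5 : Tendsto (fun x => x / G) (𝓝 (G * cos θ)) (𝓝 (cos θ)) := by
    have : ContinuousAt (fun x => x / G) (G * cos θ) := by fun_prop
    simpa [ContinuousAt, hx] using this
  filter_upwards [h5.eventually (lt_mem_nhds (show (-1 : ℝ) < cos θ by linarith)),
    h5.eventually (gt_mem_nhds hc1)] with x h6 h7
  simp only [Function.comp]
  rw [cos_arccos h6.le h7.le]
  congr 1
  field_simp

lemma LipschitzWith.comp_mul_cos (hL : LipschitzWith K ψ) (G : ℝ) :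
    LipschitzWith (K * (Real.nnabs G * 1)) fun t => ψ (G * cos t) := by
  have h : LipschitzWith (Real.nnabs G) fun x => G * x :=
    LipschitzWith.of_dist_le_mul fun x y => by simp [Real.dist_eq, ← mul_sub, abs_mul]
  exact hL.comp (h.comp lipschitzWith_cos)

lemma LipschitzWith.ae_differentiableAt_mul_cos (hL : LipschitzWith K ψ) {G : ℝ} (hG : G ≠ 0) :
    ∀ᵐ θ, θ ∈ Set.Ioo (-(π / 2)) (π / 2) → DifferentiableAt ℝ ψ (G * cos θ) := by
  filter_upwards [(hL.comp_mul_cos G).ae_differentiableAt_real,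
    (Set.countable_singleton (0 : ℝ)).ae_notMem volume] with θ h1 h2 h3
  exact differentiableAt_of_comp_mul_cos hG h3 h2 h1

lemma LipschitzWith.ae_differentiableAt_mul_cos_uIoc (hL : LipschitzWith K ψ) {G : ℝ}
    (hG : G ≠ 0) :
    ∀ᵐ θ, θ ∈ Set.uIoc (-(π / 2)) (π / 2) → DifferentiableAt ℝ ψ (G * cos θ) := by
  filter_upwards [hL.ae_differentiableAt_mul_cos hG,
    (Set.countable_singleton (π / 2)).ae_notMem volume] with θ h1 h2 h3
  rw [Set.uIoc_of_le (by linarith [pi_pos])] at h3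
  exact h1 ⟨h3.1, lt_of_le_of_ne h3.2 h2⟩

lemma LipschitzWith.inv_of_one_le (hL : LipschitzWith K ψ) (h1 : ∀ x, 1 ≤ ψ x) :
    LipschitzWith K fun x => (ψ x)⁻¹ := by
  refine LipschitzWith.of_dist_le_mul fun x y => le_trans ?_ (hL.dist_le_mul x y)
  have hx := h1 x
  have hy := h1 y
  have : (ψ x)⁻¹ - (ψ y)⁻¹ = (ψ x)⁻¹ * (ψ y)⁻¹ * (ψ y - ψ x) := by field_simp
  rw [Real.dist_eq, Real.dist_eq, this, abs_mul, abs_sub_comm (ψ x)]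
  refine mul_le_of_le_one_left (abs_nonneg _) ?_
  rw [abs_of_nonneg (by positivity)]
  exact mul_le_one₀ (inv_le_one_of_one_le₀ hx) (by positivity) (inv_le_one_of_one_le₀ hy)

lemma intervalIntegrable_of_abs_le {F : ℝ → ℝ} (hm : Measurable F) {M : ℝ} (hM : ∀ x, |F x| ≤ M)
    (a b : ℝ) : IntervalIntegrable F volume a b := by
  exact (intervalIntegrable_const (c := M)).mono_fun' hm.aestronglyMeasurable
    (Eventually.of_forall hM)

/-- Integrability of a bounded factor times the derivative of a Lipschitz function. -/
lemma LipschitzWith.intervalIntegrable_mul_deriv (hL : LipschitzWith K ψ) (G : ℝ) {F : ℝ → ℝ}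
    (hF : Continuous F) {M : ℝ} (hM : ∀ x, |F x| ≤ M) (a b : ℝ) :
    IntervalIntegrable (fun θ => F θ * deriv ψ (G * cos θ)) volume a b := by
  refine intervalIntegrable_of_abs_le (M := M * K) ?_ (fun x => ?_) a b
  · exact hF.measurable.mul ((measurable_deriv ψ).comp (by fun_prop))
  · rw [abs_mul]
    exact mul_le_mul (hM x) (norm_deriv_le_of_lipschitz hL) (abs_nonneg _)
      ((abs_nonneg _).trans (hM x))

lemma integral_sin_div_profile (hL : LipschitzWith K ψ) (h1 : ∀ x, 1 ≤ ψ x) {G : ℝ} (hG : G ≠ 0) :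
    (∫ θ in (-(π / 2))..(π / 2), (cos θ / ψ (G * cos θ) +
      G * (sin θ ^ 2 / ψ (G * cos θ) ^ 2 * deriv ψ (G * cos θ)))) =
      1 / ψ 0 + 1 / ψ 0 := by
  have hac : AbsolutelyContinuousOnInterval (fun θ => sin θ * (ψ (G * cos θ))⁻¹)
      (-(π / 2)) (π / 2) :=
    (lipschitzWith_sin.lipschitzOnWith.absolutelyContinuousOnInterval).fun_mul
      ((hL.inv_of_one_le h1).comp_mul_cos G).lipschitzOnWith.absolutelyContinuousOnInterval
  have := hac.integral_deriv_eq_sub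
  simp only [cos_pi_div_two, cos_neg, sin_neg, sin_pi_div_two, mul_zero] at this
  rw [show 1 / ψ 0 + 1 / ψ 0 = 1 * (ψ 0)⁻¹ - -1 * (ψ 0)⁻¹ by ring, ← this]
  refine intervalIntegral.integral_congr_ae ?_
  filter_upwards [hL.ae_differentiableAt_mul_cos_uIoc hG] with θ hd hθ
  have hψ : ψ (G * cos θ) ≠ 0 := (zero_lt_one.trans_le (h1 _)).ne'
  have hc : HasDerivAt (fun t => ψ (G * cos t)) (deriv ψ (G * cos θ) * (G * -sin θ)) θ :=
    (hd hθ).hasDerivAt.comp θ ((hasDerivAt_cos θ).const_mul G)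
  refine Eq.trans ?_ ((hasDerivAt_sin θ).mul (hc.inv hψ)).deriv.symm
  simp only [Pi.inv_apply]
  field_simp

lemma integral_cos_sq_sin_div_profile (hL : LipschitzWith K ψ) (h1 : ∀ x, 1 ≤ ψ x) {G : ℝ}
    (hG : G ≠ 0) :
    (∫ θ in (-(π / 2))..(π / 2), (cos θ / ψ (G * cos θ) ^ 3 -
      3 * (cos θ * sin θ ^ 2 / ψ (G * cos θ) ^ 3) +
      3 * G * (cos θ ^ 2 * sin θ ^ 2 / ψ (G * cos θ) ^ 4 * deriv ψ (G * cos θ)))) = 0 := by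
  have hq : AbsolutelyContinuousOnInterval (fun θ => (ψ (G * cos θ))⁻¹) (-(π / 2)) (π / 2) :=
    ((hL.inv_of_one_le h1).comp_mul_cos G).lipschitzOnWith.absolutelyContinuousOnInterval
  have hcos : AbsolutelyContinuousOnInterval cos (-(π / 2)) (π / 2) :=
    lipschitzWith_cos.lipschitzOnWith.absolutelyContinuousOnInterval
  have hsin : AbsolutelyContinuousOnInterval sin (-(π / 2)) (π / 2) :=
    lipschitzWith_sin.lipschitzOnWith.absolutelyContinuousOnInterval
  have := (((hq.fun_mul hq).fun_mul hq).fun_mul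
    ((hcos.fun_mul hcos).fun_mul hsin)).integral_deriv_eq_sub
  simp only [cos_pi_div_two, cos_neg, mul_zero, zero_mul, sub_zero] at this
  rw [← this]
  refine intervalIntegral.integral_congr_ae ?_
  filter_upwards [hL.ae_differentiableAt_mul_cos_uIoc hG] with θ hd hθ
  have hψ : ψ (G * cos θ) ≠ 0 := (zero_lt_one.trans_le (h1 _)).ne'
  have hc : HasDerivAt (fun t => ψ (G * cos t)) (deriv ψ (G * cos θ) * (G * -sin θ)) θ :=
    (hd hθ).hasDerivAt.comp θ ((hasDerivAt_cos θ).const_mul G)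
  have hi := hc.inv hψ
  have hcs := ((hasDerivAt_cos θ).mul (hasDerivAt_cos θ)).mul (hasDerivAt_sin θ)
  refine Eq.trans ?_ (((hi.mul hi).mul hi).mul hcs).deriv.symm
  have h3 : cos θ ^ 3 = cos θ - cos θ * sin θ ^ 2 := by
    rw [sin_sq]; ring
  simp only [Pi.mul_apply, Pi.inv_apply]
  generalize deriv ψ (G * cos θ) = d
  generalize ψ (G * cos θ) = w at hψ
  field_simp
  linear_combination (-w) * h3

/-- The edge-stopping function of an amoeba metric in terms of its profile. -/
def edgeStop (ψ : ℝ → ℝ) (z : ℝ) : ℝ :=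
  1 / 2 * ∫ θ in (-(π / 2))..(π / 2), cos θ / ψ (z * cos θ) ^ 3

/-- The derivative of `edgeStop ψ`. -/
def edgeStopDeriv (ψ : ℝ → ℝ) (z : ℝ) : ℝ :=
  -(3 / 2) * ∫ θ in (-(π / 2))..(π / 2), cos θ ^ 2 / ψ (z * cos θ) ^ 4 * deriv ψ (z * cos θ)

lemma abs_inv_pow_sub_inv_pow_le {a b : ℝ} (ha : 1 ≤ a) (hb : 1 ≤ b) :
    |1 / a ^ 3 - 1 / b ^ 3| ≤ 3 * |a - b| := by
  have h2 : 1 / a ^ 3 - 1 / b ^ 3 = (b - a) * ((b ^ 2 + a * b + a ^ 2) / (a ^ 3 * b ^ 3)) := by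
    field_simp; ring
  rw [h2, abs_mul, abs_sub_comm, mul_comm]
  refine mul_le_mul_of_nonneg_right ?_ (abs_nonneg _)
  rw [abs_of_nonneg (by positivity), div_le_iff₀ (by positivity)]
  have e1 : b ^ 2 ≤ b ^ 3 := pow_le_pow_right₀ hb (by norm_num)
  have e2 : a ^ 2 ≤ a ^ 3 := pow_le_pow_right₀ ha (by norm_num)
  have e3 : 1 ≤ a ^ 3 := one_le_pow₀ ha
  have e4 : 1 ≤ b ^ 3 := one_le_pow₀ hb
  have e5 : a ≤ a ^ 3 := le_self_pow₀ ha (by norm_num)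
  have e6 : b ≤ b ^ 3 := le_self_pow₀ hb (by norm_num)
  have : a * b ≤ a ^ 3 * b ^ 3 := mul_le_mul e5 e6 (by linarith) (by linarith)
  nlinarith

lemma hasDerivAt_edgeStop (hL : LipschitzWith K ψ) (h1 : ∀ x, 1 ≤ ψ x) {z : ℝ} (hz : z ≠ 0) :
    HasDerivAt (edgeStop ψ) (edgeStopDeriv ψ z) z := by
  have hψ0 : ∀ x, ψ x ≠ 0 := fun x => (zero_lt_one.trans_le (h1 x)).ne'
  have hψc : Continuous ψ := hL.continuous
  have hc : ∀ z, Continuous fun θ => cos θ / ψ (z * cos θ) ^ 3 := fun z =>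
    continuous_cos.div (by fun_prop) fun θ => pow_ne_zero _ (hψ0 _)
  have key := intervalIntegral.hasDerivAt_integral_of_dominated_loc_of_lip (μ := volume)
    (F := fun z θ => cos θ / ψ (z * cos θ) ^ 3) (x₀ := z) (s := Set.univ) (a := -(π / 2))
    (b := π / 2) (bound := fun _ => 3 * K)
    (F' := fun θ => -3 * (cos θ ^ 2 / ψ (z * cos θ) ^ 4 * deriv ψ (z * cos θ)))
    univ_mem (Eventually.of_forall fun z => (hc z).aestronglyMeasurable)
    ((hc z).intervalIntegrable _ _) ?_ ?_ intervalIntegrable_const ?_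
  · have := key.2.const_mul (1 / 2)
    rw [intervalIntegral.integral_const_mul] at this
    unfold edgeStopDeriv
    exact this.congr_deriv (by ring)
  · have : Measurable fun θ => -3 * (cos θ ^ 2 / ψ (z * cos θ) ^ 4 * deriv ψ (z * cos θ)) := by
      have h2 := hψc.measurable
      have h3 := measurable_deriv ψ
      fun_prop
    exact this.aestronglyMeasurable
  · refine Eventually.of_forall fun θ _ => LipschitzWith.lipschitzOnWith ?_
    refine LipschitzWith.of_dist_le_mul fun x y => ?_
    have hK : (0 : ℝ) ≤ 3 * K := by positivity
    rw [Real.coe_nnabs, abs_of_nonneg hK, Real.dist_eq, Real.dist_eq, div_eq_mul_one_div,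
      div_eq_mul_one_div (cos θ), ← mul_sub, abs_mul]
    calc |cos θ| * |1 / ψ (x * cos θ) ^ 3 - 1 / ψ (y * cos θ) ^ 3|
        ≤ 1 * (3 * |ψ (x * cos θ) - ψ (y * cos θ)|) :=
          mul_le_mul (abs_cos_le_one θ) (abs_inv_pow_sub_inv_pow_le (h1 _) (h1 _))
            (abs_nonneg _) zero_le_one
      _ ≤ 1 * (3 * (K * |x - y|)) := by
          have h2 := hL.dist_le_mul (x * cos θ) (y * cos θ)
          rw [Real.dist_eq, Real.dist_eq, ← sub_mul, abs_mul] at h2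
          have h3 : |x - y| * |cos θ| ≤ |x - y| :=
            mul_le_of_le_one_right (abs_nonneg _) (abs_cos_le_one θ)
          have h4 : K * (|x - y| * |cos θ|) ≤ K * |x - y| := by gcongr
          linarith
      _ = 3 * K * |x - y| := by ring
  · filter_upwards [hL.ae_differentiableAt_mul_cos_uIoc hz] with θ hd hθ
    have h2 : HasDerivAt (fun t => ψ (t * cos θ)) (deriv ψ (z * cos θ) * cos θ) z := by
      have := (hd hθ).hasDerivAt.comp z ((hasDerivAt_id z).mul_const (cos θ))
      simpa [Function.comp_def] using this
    have h3 := ((h2.pow 3).inv (pow_ne_zero 3 (hψ0 _))).const_mul (cos θ)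
    refine HasDerivAt.congr_deriv (f := fun x => cos θ / ψ (x * cos θ) ^ 3) h3 ?_
    have := hψ0 (z * cos θ)
    simp only [Pi.pow_apply]
    generalize deriv ψ (z * cos θ) = d
    generalize ψ (z * cos θ) = w at this
    field_simp
    norm_num
    ring

/-- The angular density of the first variation of the area of an amoeba on one side of a level
line, for Hessian entries `a` (along the gradient) and `b` (along the level line) and a shift `k` of
the level. -/
def profileVariation (ψ : ℝ → ℝ) (G k a b θ : ℝ) : ℝ :=
  ((ψ (G * cos θ) - G * cos θ * deriv ψ (G * cos θ)) * cos θ *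
      (k - b * (ψ (G * cos θ))⁻¹ ^ 2 * sin θ ^ 2 / 2) / G +
    deriv ψ (G * cos θ) * (k + a * (ψ (G * cos θ))⁻¹ ^ 2 * cos θ ^ 2 / 2)) / ψ (G * cos θ) ^ 2

/-- The first variation of the area on one side of the level line, in closed form. -/
lemma integral_profile_variation (hL : LipschitzWith K ψ) (h1 : ∀ x, 1 ≤ ψ x) (h0 : ψ 0 = 1)
    {G : ℝ} (hG : G ≠ 0) (k a b : ℝ) :
    IntervalIntegrable (profileVariation ψ G k a b) volume (-(π / 2)) (π / 2) ∧
    ∫ θ in (-(π / 2))..(π / 2), profileVariation ψ G k a b θ =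
      2 * k / G - b * edgeStop ψ G / (3 * G) - a * edgeStopDeriv ψ G / 3 := by
  have hψ0 : ∀ x, ψ x ≠ 0 := fun x => (zero_lt_one.trans_le (h1 x)).ne'
  have hψc : Continuous ψ := hL.continuous
  have hcont : ∀ (P : ℝ → ℝ) (n : ℕ), Continuous P →
      Continuous fun θ => P θ / ψ (G * cos θ) ^ n := fun P n hP =>
    hP.div (by fun_prop) fun θ => pow_ne_zero _ (hψ0 _)
  have hbd : ∀ (P : ℝ → ℝ) (n : ℕ), (∀ θ, |P θ| ≤ 1) → ∀ θ, |P θ / ψ (G * cos θ) ^ n| ≤ 1 := by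
    intro P n hP θ
    have := one_le_pow₀ (n := n) (h1 (G * cos θ))
    rw [abs_div, abs_of_pos (zero_lt_one.trans_le this)]
    exact div_le_one_of_le₀ ((hP θ).trans this) (by positivity)
  have hs2 : ∀ θ, |sin θ ^ 2| ≤ 1 := fun θ => by
    rw [abs_pow]; exact pow_le_one₀ (abs_nonneg _) (abs_sin_le_one θ)
  have hc2 : ∀ θ, |cos θ ^ 2| ≤ 1 := fun θ => by
    rw [abs_pow]; exact pow_le_one₀ (abs_nonneg _) (abs_cos_le_one θ)
  have hcs2 : ∀ θ, |cos θ ^ 2 * sin θ ^ 2| ≤ 1 := fun θ => by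
    rw [abs_mul]; exact mul_le_one₀ (hc2 θ) (abs_nonneg _) (hs2 θ)
  have iP0 : IntervalIntegrable (fun θ => cos θ / ψ (G * cos θ)) volume (-(π / 2)) (π / 2) := by
    simpa using (hcont cos 1 continuous_cos).intervalIntegrable (μ := volume) (-(π / 2)) (π / 2)
  have iR := (hcont cos 3 continuous_cos).intervalIntegrable (μ := volume) (-(π / 2)) (π / 2)
  have iQ0 := (hcont (fun θ => cos θ * sin θ ^ 2) 3 (by fun_prop)).intervalIntegrable
    (μ := volume) (-(π / 2)) (π / 2)
  have iP1 := hL.intervalIntegrable_mul_deriv G (hcont (fun θ => sin θ ^ 2) 2 (by fun_prop))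
    (hbd _ 2 hs2) (-(π / 2)) (π / 2)
  have iQ1 := hL.intervalIntegrable_mul_deriv G
    (hcont (fun θ => cos θ ^ 2 * sin θ ^ 2) 4 (by fun_prop)) (hbd _ 4 hcs2) (-(π / 2)) (π / 2)
  have iD := hL.intervalIntegrable_mul_deriv G (hcont (fun θ => cos θ ^ 2) 4 (by fun_prop))
    (hbd _ 4 hc2) (-(π / 2)) (π / 2)
  have I1 := integral_sin_div_profile hL h1 hG
  have I2 := integral_cos_sq_sin_div_profile hL h1 hG
  rw [h0, intervalIntegral.integral_add iP0 (iP1.const_mul G),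
    intervalIntegral.integral_const_mul] at I1
  rw [intervalIntegral.integral_add (iR.sub (iQ0.const_mul 3)) (iQ1.const_mul (3 * G)),
    intervalIntegral.integral_sub iR (iQ0.const_mul 3), intervalIntegral.integral_const_mul,
    intervalIntegral.integral_const_mul] at I2
  have hpt : profileVariation ψ G k a b = fun θ =>
      k / G * (cos θ / ψ (G * cos θ)) + k * (sin θ ^ 2 / ψ (G * cos θ) ^ 2 * deriv ψ (G * cos θ)) +
      (-b / (2 * G)) * (cos θ * sin θ ^ 2 / ψ (G * cos θ) ^ 3) +
      b / 2 * (cos θ ^ 2 * sin θ ^ 2 / ψ (G * cos θ) ^ 4 * deriv ψ (G * cos θ)) +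
      a / 2 * (cos θ ^ 2 / ψ (G * cos θ) ^ 4 * deriv ψ (G * cos θ)) := by
    funext θ
    have := hψ0 (G * cos θ)
    rw [profileVariation, sin_sq]
    field_simp
    ring
  rw [hpt]
  refine ⟨((((iP0.const_mul _).add (iP1.const_mul _)).add (iQ0.const_mul _)).add
    (iQ1.const_mul _)).add (iD.const_mul _), ?_⟩
  rw [intervalIntegral.integral_add ((((iP0.const_mul _).add (iP1.const_mul _)).add
      (iQ0.const_mul _)).add (iQ1.const_mul _)) (iD.const_mul _),
    intervalIntegral.integral_add (((iP0.const_mul _).add (iP1.const_mul _)).add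
      (iQ0.const_mul _)) (iQ1.const_mul _),
    intervalIntegral.integral_add ((iP0.const_mul _).add (iP1.const_mul _)) (iQ0.const_mul _),
    intervalIntegral.integral_add (iP0.const_mul _) (iP1.const_mul _)]
  simp_rw [intervalIntegral.integral_const_mul]
  unfold edgeStop edgeStopDeriv
  generalize (∫ θ in (-(π / 2))..(π / 2), cos θ / ψ (G * cos θ)) = i1 at *
  generalize (∫ θ in (-(π / 2))..(π / 2), cos θ / ψ (G * cos θ) ^ 3) = i2 at *
  generalize (∫ θ in (-(π / 2))..(π / 2), cos θ * sin θ ^ 2 / ψ (G * cos θ) ^ 3) = i3 at *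
  generalize (∫ θ in (-(π / 2))..(π / 2),
    sin θ ^ 2 / ψ (G * cos θ) ^ 2 * deriv ψ (G * cos θ)) = i4 at *
  generalize (∫ θ in (-(π / 2))..(π / 2),
    cos θ ^ 2 * sin θ ^ 2 / ψ (G * cos θ) ^ 4 * deriv ψ (G * cos θ)) = i5 at *
  generalize (∫ θ in (-(π / 2))..(π / 2),
    cos θ ^ 2 / ψ (G * cos θ) ^ 4 * deriv ψ (G * cos θ)) = i6 at *
  field_simp
  linear_combination 6 * k * I1 + b * I2

end Profile

/-- The profile of an amoeba metric: the length of a unit step along which the image changes at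
rate `c`. -/
def profile (φ : ℝ × ℝ → ℝ) (β c : ℝ) : ℝ := φ (1, β * c)

namespace IsAbsoluteNorm

variable {φ : ℝ × ℝ → ℝ} {β : ℝ}

lemma one_le_profile (h : IsAbsoluteNorm φ) (c : ℝ) : 1 ≤ profile φ β c := by
  simpa [profile] using h.abs_fst_le 1 (β * c)

lemma profile_zero (h : IsAbsoluteNorm φ) : profile φ β 0 = 1 := by
  simp [profile, h.fst_axis]

lemma profile_neg (h : IsAbsoluteNorm φ) (c : ℝ) : profile φ β (-c) = profile φ β c := by
  simp [profile, h.neg_snd]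

lemma lipschitzWith_profile (h : IsAbsoluteNorm φ) : LipschitzWith (Real.nnabs β) (profile φ β) := by
  refine LipschitzWith.of_dist_le_mul fun x y => ?_
  have := h.abs_sub_le 1 (β * x) 1 (β * y)
  simpa [profile, Real.dist_eq, ← mul_sub, abs_mul] using this

lemma deriv_profile_neg (h : IsAbsoluteNorm φ) (c : ℝ) : deriv (profile φ β) (-c) = -deriv (profile φ β) c := by
  have h2 : (fun x => profile φ β (-x)) = profile φ β := funext h.profile_neg
  have := deriv_comp_neg (profile φ β) c
  rw [h2] at this
  linarith

lemma apply_eq_mul_profile (h : IsAbsoluteNorm φ) {u : ℝ} (hu : 0 < u) (v : ℝ) :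
    φ (u, β * v) = u * profile φ β (v / u) := by
  rw [profile, ← h.smul_eq hu.le, mul_one]
  congr 2
  field_simp

end IsAbsoluteNorm

section EdgeStop

open Real

variable {ν : ℝ → ℝ} {β z : ℝ}

lemma phiOf_profile_mul_cos (hβ : 0 < β) (hz : 0 < z) {c : ℝ} (hc : 0 < c) :
    ν (1 / (β * z) / c) * c = profile (phiOf ν) β (z * c) * (1 / (β * z)) := by
  have h1 : 0 < β * (z * c) := by positivity
  have h2 : |1 / (β * (z * c))| = 1 / (β * z) / c := by
    rw [abs_of_pos (by positivity)]; field_simp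
  rw [profile, phiOf]
  simp only [h1.ne', if_false, abs_of_pos h1, h2]
  field_simp

lemma integral_sq_indicator_le {t : ℝ} (h0 : 0 ≤ t) (h1 : t ≤ 1) :
    ∫ ξ in Set.Ioc (0 : ℝ) 1, (if ξ ≤ t then ξ ^ 2 else 0) = t ^ 3 / 3 := by
  have h2 : ∀ ξ : ℝ, (if ξ ≤ t then ξ ^ 2 else 0) = (Set.Iic t).indicator (fun ξ => ξ ^ 2) ξ :=
    fun ξ => by simp [Set.indicator_apply]
  simp_rw [h2]
  rw [setIntegral_indicator measurableSet_Iic, Set.Ioc_inter_Iic, min_eq_right h1,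
    ← intervalIntegral.integral_of_le h0, integral_pow]
  norm_num

lemma integral_inv_cos_sq {α : ℝ} (h0 : 0 ≤ α) (h1 : α < π / 2) :
    ∫ θ in (0 : ℝ)..α, 1 / cos θ ^ 2 = tan α := by
  have hc : ∀ θ ∈ Set.uIcc 0 α, 0 < cos θ := fun θ hθ => by
    rw [Set.uIcc_of_le h0] at hθ
    exact cos_pos_of_mem_Ioo ⟨by linarith [hθ.1, pi_pos], by linarith [hθ.2]⟩
  rw [intervalIntegral.integral_eq_sub_of_hasDerivAt (fun θ hθ => hasDerivAt_tan (hc θ hθ).ne'),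
    tan_zero, sub_zero]
  refine ContinuousOn.intervalIntegrable fun θ hθ => ?_
  exact (continuousAt_const.div (continuous_cos.pow 2).continuousAt
    (pow_ne_zero _ (hc θ hθ).ne')).continuousWithinAt

/-- `√(s² - a²)` as an integral over the angles `θ` with `a / cos θ ≤ s`. -/
lemma sqrt_sub_sq_eq_integral {a s : ℝ} (ha : 0 < a) (has : a ≤ s) :
    √(s ^ 2 - a ^ 2) =
      ∫ θ in Set.Ioo 0 (π / 2), (if a / cos θ ≤ s then a / cos θ ^ 2 else 0) := by
  have hs : 0 < s := ha.trans_le has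
  have hpi := pi_pos
  have hx0 : 0 < a / s := by positivity
  have hx1 : a / s ≤ 1 := div_le_one_of_le₀ has hs.le
  have h0 : 0 ≤ arccos (a / s) := arccos_nonneg _
  have h1 : arccos (a / s) < π / 2 := arccos_lt_pi_div_two.2 hx0
  have h2 : ∀ θ ∈ Set.Ioo 0 (π / 2), (if a / cos θ ≤ s then a / cos θ ^ 2 else 0) =
      (Set.Iic (arccos (a / s))).indicator (fun θ => a * (1 / cos θ ^ 2)) θ := by
    intro θ hθ
    have hc : 0 < cos θ := cos_pos_of_mem_Ioo ⟨by linarith [hθ.1], hθ.2⟩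
    have h3 : a / cos θ ≤ s ↔ θ ≤ arccos (a / s) := by
      rw [div_le_iff₀ hc, mul_comm, ← div_le_iff₀ hs]
      constructor
      · intro h
        rw [← arccos_cos hθ.1.le (by linarith [hθ.2])]
        exact arccos_le_arccos h
      · intro h
        rw [← cos_arccos (by linarith) hx1]
        exact cos_le_cos_of_nonneg_of_le_pi hθ.1.le (by linarith) h
    simp only [Set.indicator_apply, Set.mem_Iic, h3, mul_one_div]
  rw [setIntegral_congr_fun measurableSet_Ioo h2, setIntegral_indicator measurableSet_Iic]
  have h4 : Set.Ioo 0 (π / 2) ∩ Set.Iic (arccos (a / s)) = Set.Ioc 0 (arccos (a / s)) := by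
    ext θ
    simp only [Set.mem_inter_iff, Set.mem_Ioo, Set.mem_Iic, Set.mem_Ioc]
    exact ⟨fun h => ⟨h.1.1, h.2⟩, fun h => ⟨⟨h.1, h.2.trans_lt h1⟩, h.2⟩⟩
  rw [h4, ← intervalIntegral.integral_of_le h0, intervalIntegral.integral_const_mul,
    integral_inv_cos_sq h0 h1, tan_arccos]
  have h5 : s ^ 2 - a ^ 2 = s ^ 2 * (1 - (a / s) ^ 2) := by field_simp
  rw [h5, sqrt_mul (by positivity), sqrt_sq hs.le]
  field_simp

/-- The edge-stopping function of the amoeba metric, written as an angular average. -/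
theorem edgeStop_profile_eq (hφ : IsAbsoluteNorm (phiOf ν)) (hν_mono : StrictMonoOn ν (Set.Ici 0))
    (hν_maps : Set.MapsTo ν (Set.Ici 0) (Set.Ici 1)) (hν_surj : Set.SurjOn ν (Set.Ici 0) (Set.Ici 1))
    {νinv : ℝ → ℝ} (hinv : ∀ z ∈ Set.Ici (0 : ℝ), νinv (ν z) = z) (hβ : 0 < β) (hz : 0 < z) :
    3 / (β ^ 2 * z ^ 2 * (ν (1 / (β * z))) ^ 3) *
        ∫ ξ in (0 : ℝ)..1, ξ ^ 2 *
          √((νinv (ν (1 / (β * z)) / ξ)) ^ 2 - 1 / (β ^ 2 * z ^ 2)) =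
      edgeStop (profile (phiOf ν) β) z := by
  have hpi := pi_pos
  have hprof := fun c (hc : 0 < c) => phiOf_profile_mul_cos (ν := ν) hβ hz hc
  have ha : 0 < 1 / (β * z) := by positivity
  have ha2 : 1 / (β ^ 2 * z ^ 2) = (1 / (β * z)) ^ 2 := by rw [div_pow, one_pow, mul_pow]
  have ha3 : 3 / (β ^ 2 * z ^ 2 * (ν (1 / (β * z))) ^ 3) =
      3 * (1 / (β * z)) ^ 2 / ν (1 / (β * z)) ^ 3 := by field_simp
  rw [ha2, ha3]
  set a := 1 / (β * z) with had
  have hN1 : 1 ≤ ν a := hν_maps (Set.mem_Ici.2 ha.le)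
  set N := ν a with hN
  set ψ := profile (phiOf ν) β with hψ
  have hψ1 : ∀ c, 1 ≤ ψ c := hφ.one_le_profile
  have hψc : Continuous ψ := hφ.lipschitzWith_profile.continuous
  have hcos : ∀ θ ∈ Set.Ioo 0 (π / 2), 0 < cos θ := fun θ hθ =>
    cos_pos_of_mem_Ioo ⟨by linarith [hθ.1], hθ.2⟩
  have h1 : ∀ ξ ∈ Set.Ioc (0 : ℝ) 1, ξ ^ 2 * √((νinv (N / ξ)) ^ 2 - a ^ 2) =
      ∫ θ in Set.Ioo 0 (π / 2),
        (if ξ * (ψ (z * cos θ) * a) ≤ N * cos θ then ξ ^ 2 * (a / cos θ ^ 2) else 0) := by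
    intro ξ hξ
    have hNξ : N ≤ N / ξ := by
      rw [le_div_iff₀ hξ.1]; exact mul_le_of_le_one_right (by linarith) hξ.2
    obtain ⟨s, hs0, hs⟩ := hν_surj (show N / ξ ∈ Set.Ici 1 from hN1.trans hNξ)
    have has : a ≤ s := (hν_mono.le_iff_le ha.le hs0).1 (by rw [hs]; exact hNξ)
    rw [← hs, hinv s hs0, sqrt_sub_sq_eq_integral ha has, ← integral_const_mul]
    refine setIntegral_congr_fun measurableSet_Ioo fun θ hθ => ?_
    have hc := hcos θ hθ
    have h2 : a / cos θ ≤ s ↔ ξ * (ψ (z * cos θ) * a) ≤ N * cos θ := by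
      rw [← hν_mono.le_iff_le (show (0 : ℝ) ≤ a / cos θ by positivity) hs0, hs, le_div_iff₀ hξ.1,
        ← hprof _ hc, ← mul_le_mul_iff_left₀ hc]
      rw [show ν (a / cos θ) * ξ * cos θ = ξ * (ν (a / cos θ) * cos θ) by ring]
    simp only [h2, mul_ite, mul_zero]
  rw [intervalIntegral.integral_of_le zero_le_one, setIntegral_congr_fun measurableSet_Ioc h1,
    integral_integral_swap]
  · have h3 : ∀ θ ∈ Set.Ioo 0 (π / 2), ∫ ξ in Set.Ioc (0 : ℝ) 1,
        (if ξ * (ψ (z * cos θ) * a) ≤ N * cos θ then ξ ^ 2 * (a / cos θ ^ 2) else 0) =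
        N ^ 3 / (3 * a ^ 2) * (cos θ / ψ (z * cos θ) ^ 3) := by
      intro θ hθ
      have hc := hcos θ hθ
      have hψp : 0 < ψ (z * cos θ) := zero_lt_one.trans_le (hψ1 _)
      have h4 : ∀ ξ : ℝ,
          (if ξ * (ψ (z * cos θ) * a) ≤ N * cos θ then ξ ^ 2 * (a / cos θ ^ 2) else 0) =
          (a / cos θ ^ 2) * (if ξ ≤ N * cos θ / (ψ (z * cos θ) * a) then ξ ^ 2 else 0) := by
        intro ξ
        simp only [le_div_iff₀ (mul_pos hψp ha), mul_comm (a / cos θ ^ 2), ite_mul, zero_mul]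
      simp_rw [h4]
      rw [integral_const_mul, integral_sq_indicator_le]
      · field_simp
      · positivity
      · rw [div_le_one (mul_pos hψp ha), ← hprof _ hc]
        refine mul_le_mul_of_nonneg_right ?_ hc.le
        refine hν_mono.monotoneOn ha.le (show (0 : ℝ) ≤ a / cos θ by positivity) ?_
        rw [le_div_iff₀ hc]
        exact mul_le_of_le_one_right ha.le (cos_le_one θ)
    rw [setIntegral_congr_fun measurableSet_Ioo h3, integral_const_mul, edgeStop]
    have hcont : Continuous fun θ => cos θ / ψ (z * cos θ) ^ 3 :=
      continuous_cos.div (by fun_prop) fun θ =>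
        pow_ne_zero _ (zero_lt_one.trans_le (hψ1 _)).ne'
    have h5 : ∫ θ in (-(π / 2))..0, cos θ / ψ (z * cos θ) ^ 3 =
        ∫ θ in (0 : ℝ)..(π / 2), cos θ / ψ (z * cos θ) ^ 3 := by
      have := intervalIntegral.integral_comp_neg (a := 0) (b := π / 2)
        (fun θ => cos θ / ψ (z * cos θ) ^ 3)
      simp only [cos_neg, neg_zero] at this
      exact this.symm
    rw [← intervalIntegral.integral_add_adjacent_intervals
      (hcont.intervalIntegrable (μ := volume) (-(π / 2)) 0)
      (hcont.intervalIntegrable (μ := volume) 0 (π / 2)), h5,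
      intervalIntegral.integral_of_le (by positivity), integral_Ioc_eq_integral_Ioo]
    have : N ≠ 0 := by linarith
    generalize ∫ θ in Set.Ioo 0 (π / 2), cos θ / ψ (z * cos θ) ^ 3 = i
    field_simp
    norm_num
  · refine Integrable.of_bound (C := N ^ 2 / a) ?_ ?_
    · refine Measurable.aestronglyMeasurable (Measurable.ite (measurableSet_le ?_ ?_) ?_ ?_)
      · have := hψc.measurable
        fun_prop
      all_goals fun_prop
    · rw [Measure.prod_restrict]
      refine (ae_restrict_iff' (measurableSet_Ioc.prod measurableSet_Ioo)).2
        (Eventually.of_forall ?_)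
      rintro ⟨ξ, θ⟩ ⟨hξ, hθ⟩
      have hc := hcos θ hθ
      have hξ0 : 0 < ξ := hξ.1
      simp only [Function.uncurry]
      split_ifs with hle
      · have h6 : ξ * a ≤ N * cos θ := by
          refine le_trans ?_ hle
          refine mul_le_mul_of_nonneg_left ?_ hξ0.le
          exact le_mul_of_one_le_left ha.le (hψ1 _)
        have h7 : (ξ * a) ^ 2 ≤ (N * cos θ) ^ 2 := by gcongr
        rw [norm_of_nonneg (by positivity), le_div_iff₀ ha,
          show ξ ^ 2 * (a / cos θ ^ 2) * a = (ξ * a) ^ 2 / cos θ ^ 2 by ring,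
          div_le_iff₀ (by positivity), ← mul_pow]
        exact h7
      · rw [norm_zero]; positivity

end EdgeStop

open Real in
lemma abs_sqrt_add_sq_sub_le (x s y : ℝ) : |√(x ^ 2 + y ^ 2) - √(s ^ 2 + y ^ 2)| ≤ |x - s| := by
  have h := abs_norm_sub_norm_le (⟨x, y⟩ : ℂ) ⟨s, y⟩
  rw [Complex.norm_eq_sqrt_sq_add_sq, Complex.norm_eq_sqrt_sq_add_sq] at h
  refine h.trans_eq ?_
  have : (⟨x, y⟩ - ⟨s, y⟩ : ℂ) = ((x - s : ℝ) : ℂ) := by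
    apply Complex.ext <;> simp
  rw [this, Complex.norm_real, Real.norm_eq_abs]

/-- A second order model of the amoeba metric near a regular point in coordinates adapted to the
gradient: `G` is the length of the gradient, `a`, `q`, `b` the Hessian entries and `k` a shift of
the level line. -/
structure LocalModel where
  (φ : ℝ × ℝ → ℝ)
  (β G a q b k : ℝ)
  isAbsoluteNorm : IsAbsoluteNorm φ
  β_pos : 0 < β
  G_pos : 0 < G

namespace LocalModel

variable (M : LocalModel)

def hess (x y : ℝ) : ℝ := M.a * x ^ 2 + 2 * M.q * x * y + M.b * y ^ 2

/-- The first coordinate after straightening the level line. -/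
def shear (ρ x y : ℝ) : ℝ := x + ρ * (M.k - M.b * y ^ 2 / 2) / M.G

/-- The rescaled length of a segment in the metric frozen at the fraction `τ` of the segment. -/
def frozen (τ ρ x y : ℝ) : ℝ :=
  M.φ (√(M.shear ρ x y ^ 2 + y ^ 2),
    M.β * (M.G * M.shear ρ x y + ρ * τ * M.hess (M.shear ρ x y) y))

/-- The rescaled amoeba distance up to second order; both the upper bound (`δ = 1 / 2`) and the
lower bound (`δ = 0`) for the true distance are of this form. -/
def level (δ C ρ : ℝ) (x : ℝ × ℝ) : ℝ :=
  (M.frozen (1 / 2 - δ) ρ x.1 x.2 + M.frozen (1 / 2 + δ) ρ x.1 x.2) / 2 + C * ρ ^ 2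

/-- The profile as a function of the angle to the gradient. -/
def radius (θ : ℝ) : ℝ := profile M.φ M.β (M.G * Real.cos θ)

lemma continuous_frozen (τ ρ : ℝ) : Continuous fun x : ℝ × ℝ => M.frozen τ ρ x.1 x.2 := by
  refine M.isAbsoluteNorm.continuous.comp ?_
  unfold shear hess
  fun_prop

lemma continuous_level (δ C ρ : ℝ) : Continuous (M.level δ C ρ) :=
  (((M.continuous_frozen _ ρ).add (M.continuous_frozen _ ρ)).div_const 2).add continuous_const

lemma sqrt_le_frozen (τ ρ x y : ℝ) : √(M.shear ρ x y ^ 2 + y ^ 2) ≤ M.frozen τ ρ x y :=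
  (le_abs_self _).trans (M.isAbsoluteNorm.abs_fst_le _ _)

lemma sqrt_le_level (δ C ρ : ℝ) (x : ℝ × ℝ) :
    √(M.shear ρ x.1 x.2 ^ 2 + x.2 ^ 2) ≤ M.level δ C ρ x - C * ρ ^ 2 := by
  have h1 := M.sqrt_le_frozen (1 / 2 - δ) ρ x.1 x.2
  have h2 := M.sqrt_le_frozen (1 / 2 + δ) ρ x.1 x.2
  unfold level
  linarith

lemma abs_shear_sub_le {R : ℝ} {ρ x y : ℝ} (hρ : 0 ≤ ρ) (hy : |y| ≤ R) :
    |M.shear ρ x y - x| ≤ ρ * ((|M.k| + |M.b| * R ^ 2) / M.G) := by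
  have hG := M.G_pos
  rw [shear, add_sub_cancel_left, mul_div_assoc, abs_mul, abs_of_nonneg hρ, abs_div, abs_of_pos hG]
  gcongr
  refine (abs_sub _ _).trans ?_
  have : y ^ 2 ≤ R ^ 2 := sq_le_sq' (by linarith [(abs_le.1 hy).1]) (abs_le.1 hy).2
  rw [abs_div, abs_mul, abs_of_nonneg (sq_nonneg y), abs_two]
  have := mul_le_mul_of_nonneg_left this (abs_nonneg M.b)
  have : 0 ≤ |M.b| * y ^ 2 := by positivity
  linarith

lemma abs_hess_le {R x y : ℝ} (hx : |x| ≤ R) (hy : |y| ≤ R) :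
    |M.hess x y| ≤ (|M.a| + 2 * |M.q| + |M.b|) * R ^ 2 := by
  have hR : 0 ≤ R := (abs_nonneg x).trans hx
  have h1 : |x| ^ 2 ≤ R ^ 2 := by gcongr
  have h2 : |y| ^ 2 ≤ R ^ 2 := by gcongr
  have h3 : |x| * |y| ≤ R * R := by gcongr
  calc |M.hess x y| ≤ |M.a * x ^ 2| + |2 * M.q * x * y| + |M.b * y ^ 2| := abs_add_three _ _ _
    _ = |M.a| * |x| ^ 2 + 2 * |M.q| * (|x| * |y|) + |M.b| * |y| ^ 2 := by
        simp only [abs_mul, abs_pow, abs_two]; ring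
    _ ≤ |M.a| * R ^ 2 + 2 * |M.q| * (R * R) + |M.b| * R ^ 2 := by gcongr
    _ = _ := by ring

/-- The sublevel sets of `level` at `1` are uniformly bounded for small `ρ`. -/
lemma exists_bound_of_level_le (δ C : ℝ) : ∀ᶠ ρ in 𝓝[>] 0, ∀ x : ℝ × ℝ,
    M.level δ C ρ x ≤ 1 → √(M.shear ρ x.1 x.2 ^ 2 + x.2 ^ 2) ≤ 2 ∧ |x.1| ≤ 3 ∧ |x.2| ≤ 3 := by
  set D := (|M.k| + |M.b| * 2 ^ 2) / M.G with hD
  have h1 : ∀ᶠ ρ in 𝓝[>] (0 : ℝ), -(C * ρ ^ 2) < 1 := by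
    have : Tendsto (fun ρ : ℝ => -(C * ρ ^ 2)) (𝓝 0) (𝓝 (-(C * 0 ^ 2))) :=
      Continuous.tendsto (by fun_prop) _
    exact (this.mono_left nhdsWithin_le_nhds).eventually (gt_mem_nhds (by norm_num))
  have h2 : ∀ᶠ ρ in 𝓝[>] (0 : ℝ), ρ * D < 1 := by
    have : Tendsto (fun ρ : ℝ => ρ * D) (𝓝 0) (𝓝 (0 * D)) := Continuous.tendsto (by fun_prop) _
    exact (this.mono_left nhdsWithin_le_nhds).eventually (gt_mem_nhds (by norm_num))
  filter_upwards [h1, h2, self_mem_nhdsWithin] with ρ h1 h2 h3 x hx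
  have hs : √(M.shear ρ x.1 x.2 ^ 2 + x.2 ^ 2) ≤ 2 := by
    linarith [M.sqrt_le_level δ C ρ x]
  have hX1 : |M.shear ρ x.1 x.2| ≤ 2 :=
    (Real.abs_le_sqrt (le_add_of_nonneg_right (sq_nonneg _))).trans hs
  have hX2 : |x.2| ≤ 2 := (Real.abs_le_sqrt (le_add_of_nonneg_left (sq_nonneg _))).trans hs
  have h4 := M.abs_shear_sub_le (x := x.1) (le_of_lt h3) hX2
  rw [← hD] at h4
  refine ⟨hs, ?_, by linarith⟩
  rw [abs_le] at h4 hX1 ⊢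
  constructor <;> linarith

lemma exists_abs_frozen_sub_le (R τ : ℝ) : ∃ D, 0 ≤ D ∧ ∀ ρ ∈ Set.Ioc (0 : ℝ) 1,
    ∀ x y, |x| ≤ R → |y| ≤ R →
      |M.frozen τ ρ x y - M.φ (√(x ^ 2 + y ^ 2), M.β * (M.G * x))| ≤ D * ρ := by
  have hG := M.G_pos
  have hβ := M.β_pos
  set D1 := (|M.k| + |M.b| * R ^ 2) / M.G with hD1
  have hD1' : 0 ≤ D1 := by positivity
  set D2 := (|M.a| + 2 * |M.q| + |M.b|) * (R + D1) ^ 2 with hD2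
  have hD2' : 0 ≤ D2 := by positivity
  refine ⟨D1 + M.β * (M.G * D1 + |τ| * D2), by positivity, fun ρ hρ x y hx hy => ?_⟩
  have h1 := M.abs_shear_sub_le (x := x) hρ.1.le hy
  rw [← hD1] at h1
  have h2 : |M.shear ρ x y| ≤ R + D1 := by
    have h3 : ρ * D1 ≤ D1 := mul_le_of_le_one_left hD1' hρ.2
    rw [abs_le] at h1 hx ⊢
    constructor <;> linarith
  have h3 := M.abs_hess_le h2 (hy.trans (le_add_of_nonneg_right hD1'))
  rw [← hD2] at h3
  refine (M.isAbsoluteNorm.abs_sub_le _ _ _ _).trans ?_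
  have h4 := (abs_sqrt_add_sq_sub_le (M.shear ρ x y) x y).trans h1
  have h5 : |M.β * (M.G * M.shear ρ x y + ρ * τ * M.hess (M.shear ρ x y) y) - M.β * (M.G * x)| ≤
      M.β * (M.G * (ρ * D1) + ρ * |τ| * D2) := by
    rw [← mul_sub, abs_mul, abs_of_pos hβ]
    gcongr
    calc |M.G * M.shear ρ x y + ρ * τ * M.hess (M.shear ρ x y) y - M.G * x|
        = |M.G * (M.shear ρ x y - x) + ρ * τ * M.hess (M.shear ρ x y) y| := by ring_nf
      _ ≤ |M.G * (M.shear ρ x y - x)| + |ρ * τ * M.hess (M.shear ρ x y) y| := abs_add_le _ _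
      _ ≤ _ := by
          rw [abs_mul, abs_mul, abs_mul, abs_of_pos hG, abs_of_pos hρ.1]
          have hρ0 := hρ.1
          gcongr
  linarith

lemma one_le_radius (θ : ℝ) : 1 ≤ M.radius θ := M.isAbsoluteNorm.one_le_profile _

/-- The unperturbed level function in polar coordinates. -/
lemma φ_polar {σ : ℝ} (hσ : σ = 1 ∨ σ = -1) {r : ℝ} (hr : 0 < r) (θ : ℝ) :
    M.φ (√((σ * (r * Real.cos θ)) ^ 2 + (r * Real.sin θ) ^ 2),
      M.β * (M.G * (σ * (r * Real.cos θ)))) = r * M.radius θ := by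
  have h1 : (σ * (r * Real.cos θ)) ^ 2 + (r * Real.sin θ) ^ 2 = r ^ 2 := by
    have h2 : σ ^ 2 = 1 := by rcases hσ with rfl | rfl <;> norm_num
    linear_combination r ^ 2 * Real.cos θ ^ 2 * h2 + r ^ 2 * Real.sin_sq_add_cos_sq θ
  rw [h1, Real.sqrt_sq hr.le, M.isAbsoluteNorm.apply_eq_mul_profile hr, radius]
  have h3 : M.G * (σ * (r * Real.cos θ)) / r = σ * (M.G * Real.cos θ) := by field_simp
  rw [h3]
  rcases hσ with rfl | rfl
  · rw [one_mul]
  · rw [neg_one_mul, M.isAbsoluteNorm.profile_neg]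

lemma exists_abs_level_polar_sub_le (δ C : ℝ) {σ : ℝ} (hσ : σ = 1 ∨ σ = -1) :
    ∃ D, 0 ≤ D ∧ ∀ᶠ ρ in 𝓝[>] 0, ∀ r > 0, ∀ θ,
      (M.level δ C ρ (σ * (r * Real.cos θ), r * Real.sin θ) ≤ 1 ∨ r * M.radius θ ≤ 1) →
        |M.level δ C ρ (σ * (r * Real.cos θ), r * Real.sin θ) - r * M.radius θ| ≤ D * ρ := by
  obtain ⟨D1, hD1, H1⟩ := M.exists_abs_frozen_sub_le 3 (1 / 2 - δ)
  obtain ⟨D2, hD2, H2⟩ := M.exists_abs_frozen_sub_le 3 (1 / 2 + δ)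
  refine ⟨D1 + D2 + |C|, by positivity, ?_⟩
  filter_upwards [M.exists_bound_of_level_le δ C, Ioc_mem_nhdsGT zero_lt_one] with ρ h1 hρ r hr θ h
  have hb : |σ * (r * Real.cos θ)| ≤ 3 ∧ |r * Real.sin θ| ≤ 3 := by
    rcases h with h | h
    · exact (h1 _ h).2
    · have hr1 : r ≤ 1 := by nlinarith [M.one_le_radius θ]
      have hσ1 : |σ| = 1 := by rcases hσ with rfl | rfl <;> simp
      rw [abs_mul, abs_mul, abs_mul, hσ1, one_mul, abs_of_pos hr]
      constructor <;> nlinarith [Real.abs_cos_le_one θ, Real.abs_sin_le_one θ]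
  have h2 := H1 ρ hρ _ _ hb.1 hb.2
  have h3 := H2 ρ hρ _ _ hb.1 hb.2
  rw [M.φ_polar hσ hr] at h2 h3
  have h4 : |C * ρ ^ 2| ≤ |C| * ρ := by
    rw [abs_mul, abs_of_nonneg (sq_nonneg ρ)]
    gcongr
    nlinarith [hρ.1, hρ.2]
  have hρ0 := hρ.1
  unfold level
  simp only [add_mul]
  have h5 : 0 ≤ D1 * ρ := by positivity
  have h6 : 0 ≤ D2 * ρ := by positivity
  rw [abs_le] at h2 h3 h4 ⊢
  constructor <;> linarith

lemma exists_radius_bound (δ C : ℝ) {σ : ℝ} (hσ : σ = 1 ∨ σ = -1) :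
    ∃ R, ∀ᶠ ρ in 𝓝[>] 0, ∀ r > 0, ∀ θ,
      M.level δ C ρ (σ * (r * Real.cos θ), r * Real.sin θ) ≤ 1 → r ≤ R := by
  obtain ⟨D, hD, H⟩ := M.exists_abs_level_polar_sub_le δ C hσ
  refine ⟨1 + D, ?_⟩
  filter_upwards [H, Ioc_mem_nhdsGT zero_lt_one] with ρ h1 hρ r hr θ h
  have h2 := (abs_le.1 (h1 r hr θ (Or.inl h))).1
  have h3 : D * ρ ≤ D := mul_le_of_le_one_right hD hρ.2
  nlinarith [M.one_le_radius θ]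

end LocalModel

lemma IsAbsoluteNorm.hasDerivAt_comp {φ : ℝ × ℝ → ℝ} (h : IsAbsoluteNorm φ) {β : ℝ}
    {u v : ℝ → ℝ} {u' v' t : ℝ} (hu : HasDerivAt u u' t) (hv : HasDerivAt v v' t) (h0 : 0 < u t)
    (hd : DifferentiableAt ℝ (profile φ β) (v t / u t)) :
    HasDerivAt (fun x => φ (u x, β * v x))
      (u' * profile φ β (v t / u t) + deriv (profile φ β) (v t / u t) * (v' - v t / u t * u')) t := by
  have h1 := hu.mul (hd.hasDerivAt.comp t (hv.div hu h0.ne'))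
  refine (h1.congr_deriv ?_).congr_of_eventuallyEq ?_
  · simp only [Function.comp, Pi.div_apply]
    field_simp
  · filter_upwards [hu.continuousAt.eventually (lt_mem_nhds h0)] with x hx
    exact h.apply_eq_mul_profile hx (v x)

namespace LocalModel

open Real

variable (M : LocalModel)

/-- The first order variation of the level function in the direction `θ`. -/
def variation (σ θ : ℝ) : ℝ :=
  σ * ((profile M.φ M.β (M.G * cos θ) -
      M.G * cos θ * deriv (profile M.φ M.β) (M.G * cos θ)) * cos θ *
      (M.k - M.b * (M.radius θ)⁻¹ ^ 2 * sin θ ^ 2 / 2) / M.G +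
    deriv (profile M.φ M.β) (M.G * cos θ) *
      (M.k + (M.radius θ)⁻¹ ^ 2 * (M.a * cos θ ^ 2 + 2 * σ * M.q * cos θ * sin θ) / 2))

lemma hasDerivAt_frozen {σ : ℝ} (hσ : σ = 1 ∨ σ = -1) (τ t θ : ℝ)
    (hd : DifferentiableAt ℝ (profile M.φ M.β) (M.G * cos θ)) :
    HasDerivAt (fun ρ => M.frozen τ ρ (σ * (((M.radius θ)⁻¹ + ρ * t) * cos θ))
        (((M.radius θ)⁻¹ + ρ * t) * sin θ))
      (t * M.radius θ + M.variation σ θ + (τ - 1 / 2) *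
        (σ * deriv (profile M.φ M.β) (M.G * cos θ) * M.hess (σ * ((M.radius θ)⁻¹ * cos θ))
          ((M.radius θ)⁻¹ * sin θ))) 0 := by
  have hN : 0 < M.radius θ := zero_lt_one.trans_le (M.one_le_radius θ)
  have hG := M.G_pos
  set r := (M.radius θ)⁻¹ with hr
  have hr0 : 0 < r := inv_pos.2 hN
  have hσ2 : σ ^ 2 = 1 := by rcases hσ with rfl | rfl <;> norm_num
  have hsc := sin_sq_add_cos_sq θ
  set w := M.k - M.b * (r * sin θ) ^ 2 / 2 with hw
  have hrad : HasDerivAt (fun ρ => r + ρ * t) t 0 := by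
    simpa using ((hasDerivAt_id (0 : ℝ)).mul_const t).const_add r
  have hy : HasDerivAt (fun ρ => (r + ρ * t) * sin θ) (t * sin θ) 0 := hrad.mul_const _
  have hx : HasDerivAt (fun ρ => M.shear ρ (σ * ((r + ρ * t) * cos θ)) ((r + ρ * t) * sin θ))
      (σ * (t * cos θ) + w / M.G) 0 := by
    have h1 : HasDerivAt (fun ρ => M.k - M.b * ((r + ρ * t) * sin θ) ^ 2 / 2)
        (-(M.b * (2 * (r * sin θ) * (t * sin θ)) / 2)) 0 := by
      have := (((hy.pow 2).const_mul M.b).div_const 2).const_sub M.k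
      refine this.congr_deriv ?_
      norm_num
    have h2 := ((hrad.mul_const (cos θ)).const_mul σ).add
      (((hasDerivAt_id (0 : ℝ)).mul h1).div_const M.G)
    refine h2.congr_deriv ?_
    simp [hw]
  set X := fun ρ => M.shear ρ (σ * ((r + ρ * t) * cos θ)) ((r + ρ * t) * sin θ) with hX
  set Y := fun ρ => (r + ρ * t) * sin θ with hY
  have hX0 : X 0 = σ * (r * cos θ) := by simp [hX, shear]
  have hY0 : Y 0 = r * sin θ := by simp [hY]
  have hs0 : X 0 ^ 2 + Y 0 ^ 2 = r ^ 2 := by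
    rw [hX0, hY0]; linear_combination r ^ 2 * cos θ ^ 2 * hσ2 + r ^ 2 * hsc
  have hu : HasDerivAt (fun ρ => √(X ρ ^ 2 + Y ρ ^ 2)) (t + σ * cos θ * w / M.G) 0 := by
    have := ((hx.pow 2).add (hy.pow 2)).sqrt (by
      simp only [Pi.add_apply, Pi.pow_apply]; rw [hs0]; positivity)
    refine this.congr_deriv ?_
    simp only [Pi.add_apply, Pi.pow_apply]
    rw [hs0, sqrt_sq hr0.le, hX0, hY0]
    field_simp
    push_cast
    linear_combination (2 * t * M.G * r * cos θ ^ 2 * hσ2 + 2 * t * M.G * r * hsc)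
  have hv : HasDerivAt (fun ρ => M.G * X ρ + ρ * τ * M.hess (X ρ) (Y ρ))
      (M.G * (σ * (t * cos θ) + w / M.G) + τ * M.hess (σ * (r * cos θ)) (r * sin θ)) 0 := by
    have hh : DifferentiableAt ℝ (fun ρ => M.hess (X ρ) (Y ρ)) 0 := by
      have h1 := hx.differentiableAt
      have h2 := hy.differentiableAt
      unfold hess
      fun_prop
    have h1 := (hx.const_mul M.G).add
      (((hasDerivAt_id (0 : ℝ)).mul_const τ).mul hh.hasDerivAt)
    refine h1.congr_deriv ?_
    simp [hX0, hY0]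
  have hu0 : √(X 0 ^ 2 + Y 0 ^ 2) = r := by rw [hs0, sqrt_sq hr0.le]
  have hq : (M.G * X 0 + 0 * τ * M.hess (X 0) (Y 0)) / √(X 0 ^ 2 + Y 0 ^ 2) =
      σ * (M.G * cos θ) := by
    rw [hu0, hX0]; field_simp; ring
  have hdσ : DifferentiableAt ℝ (profile M.φ M.β) (σ * (M.G * cos θ)) ∧
      profile M.φ M.β (σ * (M.G * cos θ)) = M.radius θ ∧
      deriv (profile M.φ M.β) (σ * (M.G * cos θ)) =
        σ * deriv (profile M.φ M.β) (M.G * cos θ) := by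
    rcases hσ with rfl | rfl
    · simp [hd, radius]
    · simp only [neg_one_mul, M.isAbsoluteNorm.profile_neg, M.isAbsoluteNorm.deriv_profile_neg]
      refine ⟨?_, rfl, trivial⟩
      have h2 : profile M.φ M.β = (profile M.φ M.β) ∘ Neg.neg :=
        funext fun x => (M.isAbsoluteNorm.profile_neg x).symm
      rw [h2]
      exact DifferentiableAt.comp _ (by rwa [neg_neg]) differentiableAt_id.neg
  have key := M.isAbsoluteNorm.hasDerivAt_comp (β := M.β) hu hv (by rw [hu0]; exact hr0)
    (by rw [hq]; exact hdσ.1)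
  refine key.congr_deriv ?_
  rw [hq, hdσ.2.1, hdσ.2.2, variation, ← hr]
  rw [show profile M.φ M.β (M.G * cos θ) = M.radius θ from rfl]
  generalize deriv (profile M.φ M.β) (M.G * cos θ) = d
  simp only [hess, hw]
  clear_value r
  generalize M.radius θ = N
  rcases hσ with rfl | rfl
  · field_simp
    ring
  · field_simp
    ring

end LocalModel

namespace LocalModel

open Real

variable (M : LocalModel)

lemma continuous_radius : Continuous M.radius :=
  M.isAbsoluteNorm.lipschitzWith_profile.continuous.comp (by fun_prop)

lemma tendsto_level_slope (δ C : ℝ) {σ : ℝ} (hσ : σ = 1 ∨ σ = -1) (t θ : ℝ)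
    (hd : DifferentiableAt ℝ (profile M.φ M.β) (M.G * cos θ)) :
    Tendsto (fun ρ => (M.level δ C ρ (σ * (((M.radius θ)⁻¹ + ρ * t) * cos θ),
        ((M.radius θ)⁻¹ + ρ * t) * sin θ) - 1) / ρ) (𝓝[>] 0)
      (𝓝 (t * M.radius θ + M.variation σ θ)) := by
  have hN : 0 < M.radius θ := zero_lt_one.trans_le (M.one_le_radius θ)
  have h1 : HasDerivAt (fun ρ => M.level δ C ρ (σ * (((M.radius θ)⁻¹ + ρ * t) * cos θ),
      ((M.radius θ)⁻¹ + ρ * t) * sin θ)) (t * M.radius θ + M.variation σ θ) 0 := by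
    have h2 := (((M.hasDerivAt_frozen hσ (1 / 2 - δ) t θ hd).add
      (M.hasDerivAt_frozen hσ (1 / 2 + δ) t θ hd)).div_const 2).add
      (((hasDerivAt_id (0 : ℝ)).pow 2).const_mul C)
    refine h2.congr_deriv ?_
    simp only [id, Nat.cast_ofNat]
    ring
  have h0 : M.level δ C 0 (σ * (((M.radius θ)⁻¹ + 0 * t) * cos θ),
      ((M.radius θ)⁻¹ + 0 * t) * sin θ) = 1 := by
    have h3 := M.φ_polar hσ (inv_pos.2 hN) θ
    rw [inv_mul_cancel₀ hN.ne'] at h3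
    simp [level, frozen, shear, h3]
  have h4 := h1.tendsto_slope_zero_right
  simp only [zero_add, h0, smul_eq_mul] at h4
  refine h4.congr fun ρ => ?_
  rw [inv_mul_eq_div]

lemma variation_div_sq {σ : ℝ} (hσ : σ = 1 ∨ σ = -1) (θ : ℝ) :
    -M.variation σ θ / M.radius θ ^ 2 =
      -σ * profileVariation (profile M.φ M.β) M.G M.k M.a M.b θ -
        M.q * (cos θ * sin θ * (M.radius θ)⁻¹ ^ 4) * deriv (profile M.φ M.β) (M.G * cos θ) := by
  have hN : 0 < M.radius θ := zero_lt_one.trans_le (M.one_le_radius θ)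
  have hG := M.G_pos.ne'
  rw [variation, profileVariation, show profile M.φ M.β (M.G * cos θ) = M.radius θ from rfl]
  generalize deriv (profile M.φ M.β) (M.G * cos θ) = d
  rcases hσ with rfl | rfl
  · field_simp
    ring
  · field_simp
    ring

/-- The area of one half of the sublevel set of `level` at `1`. -/
def halfArea (σ δ C ρ : ℝ) : ℝ :=
  volume.real {x : ℝ × ℝ | 0 < x.1 ∧ M.level δ C ρ (σ * x.1, x.2) ≤ 1}

lemma tendsto_halfArea (δ C : ℝ) {σ : ℝ} (hσ : σ = 1 ∨ σ = -1) :
    Tendsto (fun ρ => (M.halfArea σ δ C ρ - ∫ θ in Set.Ioo (-(π / 2)) (π / 2),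
        ∫ r, radialCut (fun p => p.1 * M.radius p.2) (r, θ)) / ρ) (𝓝[>] 0)
      (𝓝 (∫ θ in Set.Ioo (-(π / 2)) (π / 2), -M.variation σ θ / M.radius θ ^ 2)) := by
  obtain ⟨D, hD, h1⟩ := M.exists_abs_level_polar_sub_le δ C hσ
  obtain ⟨R, h2⟩ := M.exists_radius_bound δ C hσ
  have hm : ∀ ρ, Measurable fun x : ℝ × ℝ => M.level δ C ρ (σ * x.1, x.2) := fun ρ =>
    ((M.continuous_level δ C ρ).comp (by fun_prop)).measurable
  have hlim : ∀ᵐ θ ∂(volume.restrict (Set.Ioo (-(π / 2)) (π / 2))), ∀ t,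
      Tendsto (fun ρ => (M.level δ C ρ (σ * (((M.radius θ)⁻¹ + ρ * t) * cos θ),
        ((M.radius θ)⁻¹ + ρ * t) * sin θ) - 1) / ρ) (𝓝[>] 0)
        (𝓝 (t * M.radius θ + M.variation σ θ)) := by
    rw [ae_restrict_iff' measurableSet_Ioo]
    filter_upwards [M.isAbsoluteNorm.lipschitzWith_profile.ae_differentiableAt_mul_cos
      M.G_pos.ne'] with θ h3 h4 t
    exact M.tendsto_level_slope δ C hσ t θ (h3 h4)
  refine (tendsto_integral_radialCut
    (E := fun ρ p => M.level δ C ρ (σ * (p.1 * cos p.2), p.1 * sin p.2))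
    M.continuous_radius.measurable M.one_le_radius (fun ρ => ?_) hD h1 hlim).congr' ?_
  · exact ((M.continuous_level δ C ρ).comp (by fun_prop)).measurable
  · filter_upwards [h2] with ρ h2
    rw [halfArea, measureReal_halfPlane_eq_integral_radialCut (hm ρ) h2]

/-- The excess of the left half of the inner model over the right half of the outer model. -/
theorem tendsto_halfArea_sub (δ C δ' C' : ℝ) :
    Tendsto (fun ρ => (M.halfArea (-1) δ C ρ - M.halfArea 1 δ' C' ρ) / ρ) (𝓝[>] 0)
      (𝓝 (2 * (2 * M.k / M.G - M.b * edgeStop (profile M.φ M.β) M.G / (3 * M.G) -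
        M.a * edgeStopDeriv (profile M.φ M.β) M.G / 3))) := by
  have hL := M.isAbsoluteNorm.lipschitzWith_profile (β := M.β)
  have h1 := (M.tendsto_halfArea δ C (σ := -1) (Or.inr rfl)).sub
    (M.tendsto_halfArea δ' C' (σ := 1) (Or.inl rfl))
  obtain ⟨hi, hI⟩ := integral_profile_variation hL M.isAbsoluteNorm.one_le_profile
    M.isAbsoluteNorm.profile_zero M.G_pos.ne' M.k M.a M.b
  have hq : IntervalIntegrable (fun θ => M.q * (cos θ * sin θ * (M.radius θ)⁻¹ ^ 4) *
      deriv (profile M.φ M.β) (M.G * cos θ)) volume (-(π / 2)) (π / 2) := by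
    refine hL.intervalIntegrable_mul_deriv M.G (M := |M.q| * (1 * 1 * 1 ^ 4)) ?_ (fun θ => ?_) _ _
    · have := M.continuous_radius.inv₀ fun θ => (zero_lt_one.trans_le (M.one_le_radius θ)).ne'
      exact continuous_const.mul ((continuous_cos.mul continuous_sin).mul (this.pow 4))
    · have hN : 0 < M.radius θ := zero_lt_one.trans_le (M.one_le_radius θ)
      rw [abs_mul, abs_mul, abs_mul, abs_of_pos (pow_pos (inv_pos.2 hN) 4)]
      gcongr
      · exact abs_cos_le_one θ
      · exact abs_sin_le_one θ
      · exact inv_le_one_of_one_le₀ (M.one_le_radius θ)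
  have hle : -(π / 2) ≤ π / 2 := by linarith [pi_pos]
  have h3 : ∀ σ : ℝ, (σ = 1 ∨ σ = -1) →
      ∫ θ in Set.Ioo (-(π / 2)) (π / 2), -M.variation σ θ / M.radius θ ^ 2 =
      -σ * (∫ θ in (-(π / 2))..(π / 2), profileVariation (profile M.φ M.β) M.G M.k M.a M.b θ) -
        ∫ θ in (-(π / 2))..(π / 2), M.q * (cos θ * sin θ * (M.radius θ)⁻¹ ^ 4) *
          deriv (profile M.φ M.β) (M.G * cos θ) := by
    intro σ hσ
    rw [← integral_Ioc_eq_integral_Ioo, ← intervalIntegral.integral_of_le hle,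
      ← intervalIntegral.integral_const_mul, ← intervalIntegral.integral_sub (hi.const_mul _) hq]
    exact intervalIntegral.integral_congr fun θ _ => M.variation_div_sq hσ θ
  rw [h3 _ (Or.inl rfl), h3 _ (Or.inr rfl), hI] at h1
  convert h1 using 2
  · ring
  · ring

end LocalModel

/-- The shear `(s, y) ↦ (s + c y, y)`. -/
def shearEquiv (c : ℝ → ℝ) (hc : Measurable c) : ℝ × ℝ ≃ᵐ ℝ × ℝ where
  toFun x := (x.1 + c x.2, x.2)
  invFun x := (x.1 - c x.2, x.2)
  left_inv x := by simp
  right_inv x := by simp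
  measurable_toFun := by simp only [Equiv.coe_fn_mk]; fun_prop
  measurable_invFun := by simp only [Equiv.coe_fn_symm_mk]; fun_prop

lemma measurePreserving_shearEquiv (c : ℝ → ℝ) (hc : Measurable c) :
    MeasurePreserving (shearEquiv c hc) volume volume := by
  have h1 : MeasurePreserving (fun p : ℝ × ℝ => (p.1, p.2 + c p.1))
      ((volume : Measure ℝ).prod volume) ((volume : Measure ℝ).prod volume) :=
    (MeasurePreserving.id volume).skew_product (g := fun y s => s + c y)
      (by unfold Function.uncurry; fun_prop)
      (Eventually.of_forall fun y => map_add_right_eq_self volume (c y))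
  exact (Measure.measurePreserving_swap.comp h1).comp Measure.measurePreserving_swap

/-- Cartesian coordinates with respect to an orthonormal basis. -/
def planeEquiv (e : OrthonormalBasis (Fin 2) ℝ Plane) : ℝ × ℝ ≃ᵐ Plane :=
  (MeasurableEquiv.finTwoArrow.symm.trans (MeasurableEquiv.toLp 2 (Fin 2 → ℝ))).trans
    e.repr.symm.toHomeomorph.toMeasurableEquiv

lemma planeEquiv_apply (e : OrthonormalBasis (Fin 2) ℝ Plane) (x : ℝ × ℝ) :
    planeEquiv e x = x.1 • e 0 + x.2 • e 1 := by
  change e.repr.symm (WithLp.toLp 2 _) = _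
  rw [← e.sum_repr_symm, Fin.sum_univ_two]
  rfl

lemma norm_planeEquiv (e : OrthonormalBasis (Fin 2) ℝ Plane) (x : ℝ × ℝ) :
    ‖planeEquiv e x‖ = √(x.1 ^ 2 + x.2 ^ 2) := by
  change ‖e.repr.symm (WithLp.toLp 2 _)‖ = _
  rw [LinearIsometryEquiv.norm_map, EuclideanSpace.norm_eq, Fin.sum_univ_two]
  simp only [Real.norm_eq_abs, sq_abs]
  rfl

lemma measurePreserving_planeEquiv (e : OrthonormalBasis (Fin 2) ℝ Plane) :
    MeasurePreserving (planeEquiv e) volume volume :=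
  e.measurePreserving_repr_symm.comp ((PiLp.volume_preserving_toLp (Fin 2)).comp
    (volume_preserving_finTwoArrow ℝ).symm)

namespace LocalModel

variable (M : LocalModel)

/-- The rescaled coordinates in which the level line is straight. -/
def chart (e : OrthonormalBasis (Fin 2) ℝ Plane) (ρ : ℝ) (x : ℝ × ℝ) : Plane :=
  planeEquiv e (M.shear ρ x.1 x.2, x.2)

lemma volume_preimage_chart (e : OrthonormalBasis (Fin 2) ℝ Plane) {ρ : ℝ} (hρ : ρ ≠ 0)
    (p : Plane) (S : Set Plane) :
    volume ((fun x => p + ρ • M.chart e ρ x) ⁻¹' S) = ENNReal.ofReal |(ρ ^ 2)⁻¹| * volume S := by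
  have hc : Measurable fun y => ρ * (M.k - M.b * y ^ 2 / 2) / M.G := by fun_prop
  have h1 : MeasurePreserving ((shearEquiv _ hc).trans (planeEquiv e)) volume volume :=
    (measurePreserving_planeEquiv e).comp (measurePreserving_shearEquiv _ hc)
  have h2 : (fun x => p + ρ • M.chart e ρ x) ⁻¹' S =
      ((shearEquiv _ hc).trans (planeEquiv e)) ⁻¹' ((ρ • ·) ⁻¹' ((p + ·) ⁻¹' S)) := rfl
  rw [h2, h1.measure_preimage_equiv, Measure.addHaar_preimage_smul _ hρ, measure_preimage_add,
    finrank_euclideanSpace_fin]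

lemma volume_reflect (S : Set (ℝ × ℝ)) :
    volume ((fun x : ℝ × ℝ => (-x.1, x.2)) ⁻¹' S) = volume S := by
  have h1 : MeasurePreserving ((MeasurableEquiv.neg ℝ).prodCongr (MeasurableEquiv.refl ℝ))
      ((volume : Measure ℝ).prod volume) ((volume : Measure ℝ).prod volume) :=
    (Measure.measurePreserving_neg volume).prod (MeasurePreserving.id volume)
  exact h1.measure_preimage_equiv S

end LocalModel

lemma IsMedian.volume_inter_le {u : Plane → ℝ} (hu : Measurable u) {A : Set Plane} {m c : ℝ}
    (hm : IsMedian u A m) (hA : volume A ≠ ⊤) (hc : c ≤ m) :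
    volume (A ∩ {x | u x < c}) ≤ volume (A \ {x | u x < c}) := by
  have h0 : A ∩ {x | u x < c} ⊆ {x ∈ A | u x < m} :=
    fun x hx => ⟨hx.1, lt_of_lt_of_le hx.2 hc⟩
  have h1 : volume (A ∩ {x | u x < c}) ≤ volume A / 2 := (measure_mono h0).trans hm.1
  have h2 := measure_inter_add_sdiff (μ := volume) A
    (measurableSet_lt hu (measurable_const (a := c)))
  have h3 : volume A / 2 ≤ volume (A \ {x | u x < c}) := by
    by_contra! h4
    have h5 := ENNReal.add_lt_add_of_le_of_lt (ne_top_of_le_ne_top hA (measure_mono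
      Set.inter_subset_left)) h1 h4
    rw [h2, ENNReal.add_halves] at h5
    exact lt_irrefl _ h5
  exact h1.trans h3

lemma IsAbsoluteNorm.norm_sub_le_of_mem_amoeba {φ : ℝ × ℝ → ℝ} (h : IsAbsoluteNorm φ) {β ρ : ℝ}
    {f : Plane → ℝ} (hf : ContDiff ℝ 1 f) {p y : Plane} (hy : y ∈ amoeba φ β f p ρ) :
    ‖y - p‖ ≤ ρ :=
  (le_abs_self _).trans ((h.abs_fst_le _ _).trans ((h.le_amoebaDist hf p y).trans hy))

namespace LocalModel

variable (M : LocalModel)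

/-- In the sheared coordinates the half plane `s ≤ 0` lies below the level `ρ ^ 2 * k'`. -/
lemma exists_forall_taylor_lt (C : ℝ) {k' : ℝ} (hk : M.k < k') : ∀ᶠ ρ in 𝓝[>] 0,
    ∀ s y, s ≤ 0 → √(M.shear ρ s y ^ 2 + y ^ 2) ≤ 2 →
      ρ * (M.G * M.shear ρ s y) + ρ ^ 2 * M.hess (M.shear ρ s y) y / 2 + C * ρ ^ 3 <
        ρ ^ 2 * k' := by
  set E := (|M.k| + |M.b| * 2 ^ 2) / M.G with hE
  set K := |M.a| + 2 * |M.q| with hK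
  have hG := M.G_pos
  have h1 : ∀ᶠ ρ in 𝓝[>] (0 : ℝ), ρ * K < M.G := by
    have : Tendsto (fun ρ : ℝ => ρ * K) (𝓝 0) (𝓝 (0 * K)) := Continuous.tendsto (by fun_prop) _
    exact (this.mono_left nhdsWithin_le_nhds).eventually (gt_mem_nhds (by simpa using hG))
  have h2 : ∀ᶠ ρ in 𝓝[>] (0 : ℝ), ρ * (K * E + C) < k' - M.k := by
    have : Tendsto (fun ρ : ℝ => ρ * (K * E + C)) (𝓝 0) (𝓝 (0 * (K * E + C))) :=
      Continuous.tendsto (by fun_prop) _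
    exact (this.mono_left nhdsWithin_le_nhds).eventually
      (gt_mem_nhds (by rw [zero_mul]; linarith))
  filter_upwards [h1, h2, self_mem_nhdsWithin] with ρ h1 h2 h3 s y hs h4
  have hρ : 0 < ρ := h3
  have hX : |M.shear ρ s y| ≤ 2 :=
    (Real.abs_le_sqrt (le_add_of_nonneg_right (sq_nonneg _))).trans h4
  have hy : |y| ≤ 2 := (Real.abs_le_sqrt (le_add_of_nonneg_left (sq_nonneg _))).trans h4
  have h5 := M.abs_shear_sub_le (x := s) hρ.le hy
  rw [← hE] at h5
  have h6 : |M.shear ρ s y| ≤ -s + ρ * E := by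
    have := abs_add_le (M.shear ρ s y - s) s
    rw [sub_add_cancel, abs_of_nonpos hs] at this
    linarith
  have h7 : M.a * M.shear ρ s y ^ 2 / 2 + M.q * M.shear ρ s y * y ≤ K * |M.shear ρ s y| := by
    have h8 : M.a * M.shear ρ s y ^ 2 / 2 ≤ |M.a| * |M.shear ρ s y| := by
      have h9 : M.a * M.shear ρ s y ^ 2 ≤ |M.a| * (|M.shear ρ s y| * |M.shear ρ s y|) := by
        rw [← abs_mul, ← pow_two, abs_of_nonneg (sq_nonneg (M.shear ρ s y))]
        gcongr
        exact le_abs_self _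
      have h10 : |M.shear ρ s y| * |M.shear ρ s y| ≤ |M.shear ρ s y| * 2 := by gcongr
      have := mul_le_mul_of_nonneg_left h10 (abs_nonneg M.a)
      linarith
    have h11 : M.q * M.shear ρ s y * y ≤ 2 * |M.q| * |M.shear ρ s y| := by
      have h12 := le_abs_self (M.q * M.shear ρ s y * y)
      rw [abs_mul, abs_mul] at h12
      have := mul_le_mul_of_nonneg_left hy (mul_nonneg (abs_nonneg M.q)
        (abs_nonneg (M.shear ρ s y)))
      linarith
    rw [hK, add_mul]
    linarith
  have h8 : M.G * M.shear ρ s y = M.G * s + ρ * (M.k - M.b * y ^ 2 / 2) := by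
    rw [shear]; field_simp
  have h9 := mul_le_mul_of_nonneg_left h6 (show 0 ≤ K by positivity)
  have h10 : 0 ≤ ρ * (-s * (M.G - ρ * K)) :=
    mul_nonneg hρ.le (mul_nonneg (by linarith) (by linarith))
  have h11 := mul_lt_mul_of_pos_left h2 (show 0 < ρ ^ 2 by positivity)
  have h12 := mul_le_mul_of_nonneg_left (h7.trans h9) (show 0 ≤ ρ ^ 2 by positivity)
  rw [h8]
  have h13 : M.hess (M.shear ρ s y) y / 2 = M.a * M.shear ρ s y ^ 2 / 2 +
      M.q * M.shear ρ s y * y + M.b * y ^ 2 / 2 := by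
    rw [hess]; ring
  rw [mul_div_assoc (ρ ^ 2), h13]
  linarith

/-- If the level shift of the model exceeds the critical value, medians of `f` on small amoebas
stay below that level. -/
theorem eventually_median_lt {f : Plane → ℝ} (hf : ContDiff ℝ 3 f) (p : Plane)
    (e : OrthonormalBasis (Fin 2) ℝ Plane)
    (hgrad : ∀ x, fderiv ℝ f p (planeEquiv e x) = M.G * x.1)
    (hhess : ∀ x, fderiv ℝ (fderiv ℝ f) p (planeEquiv e x) (planeEquiv e x) = M.hess x.1 x.2)
    (hpos : 0 < 2 * M.k / M.G - M.b * edgeStop (profile M.φ M.β) M.G / (3 * M.G) -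
      M.a * edgeStopDeriv (profile M.φ M.β) M.G / 3) {k' : ℝ} (hk : M.k < k') {m : ℝ → ℝ}
    (hm : ∀ ρ > 0, IsMedian f (amoeba M.φ M.β f p ρ) (m ρ)) :
    ∀ᶠ ρ in 𝓝[>] 0, m ρ < f p + ρ ^ 2 * k' := by
  obtain ⟨C, hC, hb⟩ := M.isAbsoluteNorm.exists_amoebaDist_bounds M.β_pos hf p
  have hlim := (M.tendsto_halfArea_sub (1 / 2) (8 * C) 0 (-(8 * C))).eventually
    (lt_mem_nhds (mul_pos two_pos hpos))
  filter_upwards [hlim, M.exists_bound_of_level_le (1 / 2) (8 * C),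
    M.exists_bound_of_level_le 0 (-(8 * C)), M.exists_forall_taylor_lt (8 * C) hk,
    Ioc_mem_nhdsGT (show (0 : ℝ) < 1 / 2 by norm_num)] with ρ hlim hU hD hT hρ
  have hρ0 := hρ.1
  by_contra! hcm
  set A := amoeba M.φ M.β f p ρ with hA
  have hAfin : volume A ≠ ⊤ := by
    refine ne_top_of_le_ne_top (measure_closedBall_lt_top (x := p) (r := ρ)).ne
      (measure_mono fun y hy => ?_)
    rw [mem_closedBall_iff_norm]
    exact M.isAbsoluteNorm.norm_sub_le_of_mem_amoeba (hf.of_le (by norm_num)) hy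
  have hmed := (hm ρ hρ0).volume_inter_le hf.continuous.measurable hAfin hcm
  set S := {x | f x < f p + ρ ^ 2 * k'} with hS
  have hnorm : ∀ x : ℝ × ℝ, ‖M.chart e ρ x‖ = √(M.shear ρ x.1 x.2 ^ 2 + x.2 ^ 2) :=
    fun x => norm_planeEquiv e _
  have hnorm' : ∀ x : ℝ × ℝ, ‖ρ • M.chart e ρ x‖ = ρ * √(M.shear ρ x.1 x.2 ^ 2 + x.2 ^ 2) := by
    intro x
    rw [norm_smul, hnorm, Real.norm_eq_abs, abs_of_pos hρ0]
  have hφ : ∀ τ (x : ℝ × ℝ), M.φ (‖ρ • M.chart e ρ x‖, M.β * (fderiv ℝ f p (ρ • M.chart e ρ x) +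
      τ * fderiv ℝ (fderiv ℝ f) p (ρ • M.chart e ρ x) (ρ • M.chart e ρ x))) =
      ρ * M.frozen τ ρ x.1 x.2 := by
    intro τ x
    rw [frozen, ← M.isAbsoluteNorm.smul_eq hρ0.le, hnorm']
    simp only [map_smul, FunLike.coe_smul, Pi.smul_apply, chart, hgrad, hhess, smul_eq_mul]
    congr 2
    ring
  have hbd : ∀ x : ℝ × ℝ, √(M.shear ρ x.1 x.2 ^ 2 + x.2 ^ 2) ≤ 2 →
      (x.1 ≤ 0 → p + ρ • M.chart e ρ x ∈ S) ∧
      ρ * M.level 0 (-(8 * C)) ρ x ≤ amoebaDist M.φ M.β f p (p + ρ • M.chart e ρ x) ∧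
      amoebaDist M.φ M.β f p (p + ρ • M.chart e ρ x) ≤ ρ * M.level (1 / 2) (8 * C) ρ x := by
    intro x hx
    have h1 : ‖ρ • M.chart e ρ x‖ ≤ 1 := by
      rw [hnorm']
      nlinarith [hρ.2]
    obtain ⟨h2, h3, h4⟩ := hb _ h1
    have h5 : C * ‖ρ • M.chart e ρ x‖ ^ 3 ≤ 8 * C * ρ ^ 3 := by
      have : (ρ * √(M.shear ρ x.1 x.2 ^ 2 + x.2 ^ 2)) ^ 3 ≤ (ρ * 2) ^ 3 := by gcongr
      rw [hnorm']
      nlinarith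
    have h6 := hφ 0 x
    have h7 := hφ (1 / 2) x
    have h8 := hφ 1 x
    rw [zero_mul, add_zero] at h6
    rw [one_mul] at h8
    rw [one_div_mul_eq_div] at h7
    rw [h7] at h3
    rw [h6, h8] at h4
    refine ⟨fun hx1 => ?_, ?_, ?_⟩
    · have h9 := hT x.1 x.2 hx1 hx
      have h10 := (abs_le.1 h2).2
      have h11 : fderiv ℝ f p (ρ • M.chart e ρ x) = ρ * (M.G * M.shear ρ x.1 x.2) := by
        rw [map_smul, chart, hgrad, smul_eq_mul]
      have h12 : fderiv ℝ (fderiv ℝ f) p (ρ • M.chart e ρ x) (ρ • M.chart e ρ x) =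
          ρ ^ 2 * M.hess (M.shear ρ x.1 x.2) x.2 := by
        simp only [map_smul, FunLike.coe_smul, Pi.smul_apply, chart, hhess, smul_eq_mul]
        ring
      rw [h11, h12] at h10
      change f _ < _
      linarith
    · rw [level, sub_zero, add_zero]
      linarith
    · rw [level, sub_self, show (1 / 2 + 1 / 2 : ℝ) = 1 by norm_num]
      linarith
  set Θ := fun x => p + ρ • M.chart e ρ x with hΘ
  set L := {x : ℝ × ℝ | 0 < x.1 ∧ M.level (1 / 2) (8 * C) ρ (-1 * x.1, x.2) ≤ 1} with hL
  set R := {x : ℝ × ℝ | 0 < x.1 ∧ M.level 0 (-(8 * C)) ρ (1 * x.1, x.2) ≤ 1} with hR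
  have hL1 : L ⊆ (fun x : ℝ × ℝ => (-x.1, x.2)) ⁻¹' (Θ ⁻¹' (A ∩ S)) := by
    rintro x ⟨hx1, hx2⟩
    rw [neg_one_mul] at hx2
    obtain ⟨h1, h2, h3⟩ := hbd _ (hU _ hx2).1
    refine ⟨h3.trans ?_, h1 (by simpa using hx1.le)⟩
    exact mul_le_of_le_one_right hρ0.le hx2
  have hR1 : Θ ⁻¹' (A \ S) ⊆ R := by
    rintro x ⟨hx1, hx2⟩
    have h0 := M.isAbsoluteNorm.norm_sub_le_of_mem_amoeba (hf.of_le (by norm_num)) hx1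
    rw [add_sub_cancel_left, hnorm'] at h0
    have h1 : √(M.shear ρ x.1 x.2 ^ 2 + x.2 ^ 2) ≤ 1 := by
      by_contra! h
      nlinarith
    obtain ⟨h2, h3, h4⟩ := hbd x (h1.trans (by norm_num))
    refine ⟨?_, ?_⟩
    · by_contra! h
      exact hx2 (h2 h)
    · rw [one_mul]
      have h5 : ρ * M.level 0 (-(8 * C)) ρ x ≤ ρ := h3.trans hx1
      by_contra! h
      have h6 : 1 < M.level 0 (-(8 * C)) ρ x := h
      nlinarith
  have hLR : volume L ≤ volume R := by
    calc volume L ≤ volume (Θ ⁻¹' (A ∩ S)) := (measure_mono hL1).trans_eq (volume_reflect _)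
      _ ≤ volume (Θ ⁻¹' (A \ S)) := by
        rw [M.volume_preimage_chart e hρ0.ne', M.volume_preimage_chart e hρ0.ne']
        gcongr
      _ ≤ volume R := measure_mono hR1
  have hRfin : volume R ≠ ⊤ := by
    refine ne_top_of_le_ne_top (measure_closedBall_lt_top (x := (0 : ℝ × ℝ)) (r := 3)).ne
      (measure_mono fun x hx => ?_)
    have := hD _ hx.2
    simp only [one_mul] at this
    rw [mem_closedBall_zero_iff, Prod.norm_def]
    exact max_le this.2.1 this.2.2
  have hLR' : M.halfArea (-1) (1 / 2) (8 * C) ρ ≤ M.halfArea 1 0 (-(8 * C)) ρ :=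
    ENNReal.toReal_mono hRfin hLR
  have := (div_pos_iff_of_pos_right hρ0).1 hlim
  linarith

end LocalModel

lemma hasFDerivAt_gradient {f : Plane → ℝ} (hf : ContDiff ℝ 3 f) (p : Plane) :
    HasFDerivAt (gradient f)
      ((InnerProductSpace.toDual ℝ Plane).symm.toContinuousLinearEquiv.toContinuousLinearMap ∘L
      fderiv ℝ (fderiv ℝ f) p) p := by
  have h1 : DifferentiableAt ℝ (fderiv ℝ f) p :=
    ((hf.fderiv_right (m := 2) (by norm_num)).differentiable (by norm_num)) p
  exact ((InnerProductSpace.toDual ℝ Plane).symm.toContinuousLinearEquiv.hasFDerivAt).comp p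
    h1.hasFDerivAt

lemma div2_eq_sum_inner {V : Plane → Plane} {V' : Plane →L[ℝ] Plane} {p : Plane}
    (h : HasFDerivAt V V' p) (e : OrthonormalBasis (Fin 2) ℝ Plane) :
    div2 V p = ∑ i, inner ℝ (e i) (V' (e i)) := by
  have h1 := LinearMap.trace_eq_sum_inner (V' : Plane →ₗ[ℝ] Plane) e
  rw [LinearMap.trace_eq_sum_inner _ (EuclideanSpace.basisFun (Fin 2) ℝ)] at h1
  refine Eq.trans ?_ h1
  refine Finset.sum_congr rfl fun i _ => ?_
  have h2 : HasFDerivAt (fun y => V y i) ((EuclideanSpace.proj i).comp V') p :=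
    (EuclideanSpace.proj (𝕜 := ℝ) i).hasFDerivAt.comp p h
  rw [h2.fderiv, EuclideanSpace.basisFun_apply, EuclideanSpace.inner_single_left]
  simp

/-- The divergence of a normalized gradient field in a basis adapted to the gradient. -/
lemma norm_mul_div2_eq {f : Plane → ℝ} (hf : ContDiff ℝ 3 f) {p : Plane} {g : ℝ → ℝ}
    {e : OrthonormalBasis (Fin 2) ℝ Plane} {G g' : ℝ} (hG : 0 < G)
    (hw : gradient f p = G • e 0) (hg : HasDerivAt g g' G) :
    G * div2 (fun x => (g ‖gradient f x‖ / ‖gradient f x‖) • gradient f x) p =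
      G * (fderiv ℝ (fderiv ℝ f) p (e 0) (e 0)) * g' +
        fderiv ℝ (fderiv ℝ f) p (e 1) (e 1) * g G := by
  have h1 := hasFDerivAt_gradient hf p
  set W := (InnerProductSpace.toDual ℝ Plane).symm.toContinuousLinearEquiv.toContinuousLinearMap ∘L
      fderiv ℝ (fderiv ℝ f) p with hW
  have hWi : ∀ u v, inner ℝ v (W u) = fderiv ℝ (fderiv ℝ f) p u v := by
    intro u v
    rw [real_inner_comm]
    exact InnerProductSpace.toDual_symm_apply
  have hn : ‖gradient f p‖ = G := by
    rw [hw, norm_smul, e.orthonormal.1 0, mul_one, Real.norm_of_nonneg hG.le]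
  have h2 : HasFDerivAt (fun x => ‖gradient f x‖)
      ((1 / G) • (innerSL ℝ (gradient f p)).comp W) p := by
    have h3 := h1.norm_sq.sqrt (by rw [hn]; positivity)
    simp only [Real.sqrt_sq (norm_nonneg _)] at h3
    refine h3.congr_fderiv ?_
    rw [hn, ← Nat.cast_smul_eq_nsmul ℝ, smul_smul]
    congr 1
    field_simp
    norm_num
  rw [← hn] at hg
  have h4 : HasDerivAt (fun z => g z / z) ((g' * G - g G) / G ^ 2) ‖gradient f p‖ := by
    have := hg.div (hasDerivAt_id _) (by rw [hn]; exact hG.ne')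
    refine this.congr_deriv ?_
    simp [hn]
  have h5 := (h4.comp_hasFDerivAt p h2).smul h1
  rw [show div2 (fun x => (g ‖gradient f x‖ / ‖gradient f x‖) • gradient f x) p =
      div2 (((fun z => g z / z) ∘ fun x => ‖gradient f x‖) • gradient f) p from rfl,
    div2_eq_sum_inner h5 e, Fin.sum_univ_two]
  simp only [Function.comp, hn]
  simp only [hw, add_apply, smul_apply, ContinuousLinearMap.smulRight_apply,
    ContinuousLinearMap.comp_apply, innerSL_apply_apply, inner_add_right, real_inner_smul_right,
    hWi, map_smul, smul_eq_mul]
  rw [e.orthonormal.2 (show (1 : Fin 2) ≠ 0 by decide), real_inner_self_eq_norm_sq,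
    e.orthonormal.1 0]
  field_simp
  ring

theorem IsAbsoluteNorm.eventually_median_lt {φ : ℝ × ℝ → ℝ} (h : IsAbsoluteNorm φ) {β : ℝ}
    (hβ : 0 < β) {f : Plane → ℝ} (hf : ContDiff ℝ 3 f) {p : Plane} (hp : gradient f p ≠ 0)
    {m : ℝ → ℝ} (hm : ∀ ρ > 0, IsMedian f (amoeba φ β f p ρ) (m ρ)) {k : ℝ}
    (hk : ‖gradient f p‖ * div2 (fun x => (edgeStop (profile φ β) ‖gradient f x‖ /
      ‖gradient f x‖) • gradient f x) p / 6 < k) :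
    ∀ᶠ ρ in 𝓝[>] 0, m ρ < f p + ρ ^ 2 * k := by
  set G := ‖gradient f p‖ with hG
  have hG0 : 0 < G := norm_pos_iff.2 hp
  obtain ⟨e, he⟩ : ∃ e : OrthonormalBasis (Fin 2) ℝ Plane, ∀ i ∈ ({0} : Set (Fin 2)),
      e i = G⁻¹ • gradient f p := by
    refine Orthonormal.exists_orthonormalBasis_extension_of_card_eq
      (v := fun _ => G⁻¹ • gradient f p) (by simp) ⟨fun i => ?_, fun i j hij => ?_⟩
    · rw [Set.domRestrict_apply, norm_smul, norm_inv, Real.norm_of_nonneg hG0.le, ← hG,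
        inv_mul_cancel₀ hG0.ne']
    · exact absurd (Subsingleton.elim i j) hij
  have hw : gradient f p = G • e 0 := by
    rw [he 0 rfl, smul_inv_smul₀ hG0.ne']
  set H := fderiv ℝ (fderiv ℝ f) p with hH
  have hd := hasDerivAt_edgeStop (h.lipschitzWith_profile (β := β)) h.one_le_profile hG0.ne'
  have hdiv := norm_mul_div2_eq hf hG0 hw hd
  rw [hdiv, ← hH] at hk
  set T := (G * H (e 0) (e 0) * edgeStopDeriv (profile φ β) G +
    H (e 1) (e 1) * edgeStop (profile φ β) G) / 6 with hT
  let M : LocalModel :=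
    { φ := φ, β := β, G := G, a := H (e 0) (e 0), q := H (e 0) (e 1), b := H (e 1) (e 1)
      k := (T + k) / 2, isAbsoluteNorm := h, β_pos := hβ, G_pos := hG0 }
  refine M.eventually_median_lt hf p e (fun x => ?_) (fun x => ?_) ?_
    (show (T + k) / 2 < k by linarith) hm
  · have h1 : fderiv ℝ f p (planeEquiv e x) = inner ℝ (gradient f p) (planeEquiv e x) :=
      InnerProductSpace.toDual_symm_apply.symm
    rw [h1, hw, planeEquiv_apply, inner_add_right]
    simp only [real_inner_smul_left, real_inner_smul_right]
    rw [e.orthonormal.2 (show (0 : Fin 2) ≠ 1 by decide), real_inner_self_eq_norm_sq,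
      e.orthonormal.1 0]
    change _ = G * x.1
    ring
  · have hsymm : H (e 1) (e 0) = H (e 0) (e 1) :=
      (hf.contDiffAt.isSymmSndFDerivAt (by simp; norm_num)) (e 1) (e 0)
    rw [planeEquiv_apply]
    simp only [map_add, map_smul, add_apply, smul_apply,
      smul_eq_mul, LocalModel.hess, ← hH, hsymm, M]
    ring
  · have : 2 * ((T + k) / 2) / G - H (e 1) (e 1) * edgeStop (profile φ β) G / (3 * G) -
        H (e 0) (e 0) * edgeStopDeriv (profile φ β) G / 3 = (k - T) / G := by
      rw [hT]
      field_simp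
      ring
    change 0 < 2 * ((T + k) / 2) / G - H (e 1) (e 1) * edgeStop (profile φ β) G / (3 * G) -
        H (e 0) (e 0) * edgeStopDeriv (profile φ β) G / 3
    rw [this]
    exact div_pos (by linarith) hG0

lemma amoeba_neg (φ : ℝ × ℝ → ℝ) (β : ℝ) (f : Plane → ℝ) (p : Plane) (ρ : ℝ) :
    amoeba φ β (-f) p ρ = amoeba φ β f p ρ := by
  have h1 : ∀ (c : ℝ → Plane) t, |deriv ((-f) ∘ c) t| = |deriv (f ∘ c) t| := by
    intro c t
    rw [show (-f) ∘ c = -(f ∘ c) from rfl, deriv.neg, abs_neg]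
  simp only [amoeba, amoebaDist, h1]

lemma IsMedian.neg {u : Plane → ℝ} {A : Set Plane} {m : ℝ} (h : IsMedian u A m) :
    IsMedian (-u) A (-m) := by
  refine ⟨?_, ?_⟩
  · simpa only [Pi.neg_apply, neg_lt_neg_iff] using h.2
  · simpa only [Pi.neg_apply, neg_lt_neg_iff] using h.1

lemma gradient_neg (f : Plane → ℝ) (x : Plane) : gradient (-f) x = -gradient f x := by
  rw [gradient, fderiv_neg, map_neg, gradient]

lemma div2_neg (V : Plane → Plane) (x : Plane) : div2 (fun y => -V y) x = -div2 V x := by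
  simp only [div2, PiLp.neg_apply, fderiv_fun_neg, neg_apply,
    Finset.sum_neg_distrib]

/-- Amoeba median filtering approximates a time step of size ρ²/6 of the
self-snakes PDE  u_t = |∇u| div(g(|∇u|) ∇u/|∇u|), with edge-stopping function g
determined by the amoeba metric. -/
theorem amoeba_median_approximates_self_snakes
    (ν : ℝ → ℝ) (hν_cont : ContinuousOn ν (Set.Ici 0))
    (hν_mono : StrictMonoOn ν (Set.Ici 0))
    (hν0 : ν 0 = 1)
    (hν_maps : Set.MapsTo ν (Set.Ici 0) (Set.Ici 1))
    (hν_surj : Set.SurjOn ν (Set.Ici 0) (Set.Ici 1))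
    (hφ : IsNorm2 (phiOf ν))
    (νinv : ℝ → ℝ)
    (hinv_left : ∀ z ∈ Set.Ici (0:ℝ), νinv (ν z) = z)
    (hinv_right : ∀ w ∈ Set.Ici (1:ℝ), ν (νinv w) = w)
    (β : ℝ) (hβ : 0 < β)
    (f : Plane → ℝ) (hf : ContDiff ℝ 3 f) (x₀ : Plane)
    (hgrad : gradient f x₀ ≠ 0)
    (g : ℝ → ℝ)
    (hg : ∀ z > 0, g z = 3 / (β ^ 2 * z ^ 2 * (ν (1 / (β * z))) ^ 3) *
        ∫ ξ in (0:ℝ)..1, ξ ^ 2 *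
          Real.sqrt ((νinv (ν (1 / (β * z)) / ξ)) ^ 2 - 1 / (β ^ 2 * z ^ 2)))
    (m : ℝ → ℝ)
    (hm : ∀ ρ > 0, IsMedian f (amoeba (phiOf ν) β f x₀ ρ) (m ρ)) :
    (fun ρ : ℝ => m ρ - f x₀ - ρ ^ 2 / 6 *
        (‖gradient f x₀‖ *
          div2 (fun x => (g ‖gradient f x‖ / ‖gradient f x‖) • gradient f x) x₀))
      =o[𝓝[>] 0] (fun ρ : ℝ => ρ ^ 2) := by
  have h := isAbsoluteNorm_phiOf hν0 hφ
  set V := fun x => (edgeStop (profile (phiOf ν) β) ‖gradient f x‖ / ‖gradient f x‖) •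
    gradient f x with hV
  have hgV : (fun x => (g ‖gradient f x‖ / ‖gradient f x‖) • gradient f x) = V := by
    funext x
    rcases eq_or_ne (gradient f x) 0 with hx | hx
    · simp [hV, hx]
    · have hz := norm_pos_iff.2 hx
      simp only [hV]
      rw [hg _ hz, edgeStop_profile_eq h hν_mono hν_maps hν_surj hinv_left hβ hz]
  rw [hgV]
  have hnV : (fun x => (edgeStop (profile (phiOf ν) β) ‖gradient (-f) x‖ /
      ‖gradient (-f) x‖) • gradient (-f) x) = fun x => -V x := by
    funext x
    rw [gradient_neg, norm_neg, smul_neg]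
  rw [isLittleO_iff]
  intro c hc
  have hup := h.eventually_median_lt hβ hf hgrad hm
    (lt_add_of_pos_right (‖gradient f x₀‖ * div2 V x₀ / 6) hc)
  have hlo := h.eventually_median_lt hβ (f := -f) hf.neg (p := x₀) (m := -m)
    (by rw [gradient_neg]; exact neg_ne_zero.2 hgrad)
    (fun ρ hρ => by rw [amoeba_neg]; exact (hm ρ hρ).neg)
    (k := -(‖gradient f x₀‖ * div2 V x₀ / 6) + c)
    (by rw [hnV, div2_neg, gradient_neg, norm_neg]; linarith)
  filter_upwards [hup, hlo] with ρ h1 h2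
  simp only [Pi.neg_apply] at h2
  rw [Real.norm_eq_abs, Real.norm_of_nonneg (sq_nonneg ρ), abs_le]
  constructor <;> linarith
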